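/- Suppose P(λ) is regular and μ ∈ ℂ is an eigenvalue of P(λ) (det P(μ) = 0). Let L(λ) := M_{τ_1}(Y_1) M_{σ_1}(X_1) (λ M_τ^P − M_σ^P) M_{σ_2}(X_2) M_{τ_2}(Y_2) be an EGFP of P(λ) (ω = −τ). Define the n×mn matrix F^EGFP(P) by: e^T_{m−c_0(σ,σ_2)} ⊗ I_n if 0 ∈ σ and c_0(σ) < m; A_m^{−1}(e^T_1 ⊗ I_n) if 0 ∈ σ and c_0(σ) = m; e^T_{m−p} ⊗ I_n with p := i_0(ω) + c_{i_0(ω)+1}(σ,σ_2) + 1 if 0 ∈ ω, i_0(ω)+1 ∈ σ and i_0(ω) + c_{i_0(ω)+1}(σ) + 1 < m; A_m^{−1}(e^T_p ⊗ I_n) with p := c_{−(m−1)}(τ_2) + 2 if 0 ∈ ω, i_0(ω)+1 ∈ σ and i_0(ω) + c_{i_0(ω)+1}(σ) + 1 = m; e^T_{m−p} ⊗ I_n with p := i_0(ω) − c_{−i_0(ω)}(τ_2) − 1 if 0 ∈ ω, i_0(ω) < m and i_0(ω)+1 ∉ σ; and A_0^{−1}(e^T_m ⊗ I_n) if 0 ∈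 ω and i_0(ω) = m. Define K^EGFP(P) by: e^T_{m−i_0(σ_1,σ)} ⊗ I_n if 0 ∈ σ and i_0(σ) < m; A_m^{−T}(e^T_1 ⊗ I_n) if 0 ∈ σ and i_0(σ) = m; e^T_{m−p} ⊗ I_n with p := c_0(ω) + i_{c_0(ω)+1}(σ_1,σ) + 1 if 0 ∈ ω, c_0(ω)+1 ∈ σ and c_0(ω) + i_{c_0(ω)+1}(σ) + 1 < m; A_m^{−T}(e^T_p ⊗ I_n) with p := i_{−(m−1)}(τ_1) + 2 if 0 ∈ ω, c_0(ω)+1 ∈ σ and c_0(ω) + i_{c_0(ω)+1}(σ) + 1 = m; e^T_{m−p} ⊗ I_n with p := c_0(ω) − i_{−c_0(ω)}(τ_1) − 1 if 0 ∈ ω, c_0(ω) < m and c_0(ω)+1 ∉ σ; and A_0^{−T}(e^T_m ⊗ I_n) if 0 ∈ ω and c_0(ω) = m. Then x ↦ F^EGFP(P)·x is a linear isomorphism from N_r(L(μ)) onto N_r(P(μ)) and y ↦ K^EGFP(P)·y is a linear isomorphism from N_l(L(μ)) onto N_l(P(μ)); in particular, if the columns of an mn×p matrix Z of rank p form a basis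 of N_r(L(μ)) (resp. N_l(L(μ))), then the columns of F^EGFP(P)·Z (resp. K^EGFP(P)·Z) form a basis of N_r(P(μ)) (resp. N_l(P(μ))). -/

import Mathlib

open Matrix Polynomial

/-- Signed indices: `pos k` denotes `k` and `neg k` denotes `−k`, with `−0` and `0` distinct. -/
inductive SIdx : Type where
  | pos : ℕ → SIdx
  | neg : ℕ → SIdx
deriving DecidableEq

namespace SIdx

/-- The absolute value of a signed index. -/
def val : SIdx → ℕ
  | pos k => k
  | neg k => k

/-- Whether a signed index is negative. -/
def isNeg : SIdx → Bool
  | pos _ => false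
  | neg _ => true

/-- The successor `t + 1` of a signed index (`−s + 1 = −(s−1)`). -/
def succ : SIdx → SIdx
  | pos k => pos (k + 1)
  | neg 0 => pos 0
  | neg (k + 1) => neg k

/-- Negation of a signed index. -/
def negate : SIdx → SIdx
  | pos k => neg k
  | neg k => pos k

end SIdx

/-- The ascending chain `(t, t+1, …, t+p)`. -/
def chainUp (t : SIdx) : ℕ → List SIdx
  | 0 => [t]
  | p + 1 => t :: chainUp t.succ p

/-- The number of consecutions `c_t(α)` of the index tuple `α` at `t` (`−1` when `t ∉ α`):
the largest `p` such that `(t, t+1, …, t+p)` is a subtuple (sublist) of `α`. -/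
noncomputable def consAt (α : List SIdx) (t : SIdx) : ℤ :=
  letI := Classical.decPred (fun p : ℕ => (chainUp t p).Sublist α)
  if t ∈ α then (Nat.findGreatest (fun p : ℕ => (chainUp t p).Sublist α) α.length : ℤ) else -1

/-- The number of inversions `i_t(α)` of the index tuple `α` at `t` (`−1` when `t ∉ α`):
the largest `q` such that `(t+q, …, t+1, t)` is a subtuple (sublist) of `α`. -/
noncomputable def invsAt (α : List SIdx) (t : SIdx) : ℤ :=
  letI := Classical.decPred (fun p : ℕ => ((chainUp t p).reverse).Sublist α)
  if t ∈ α then (Nat.findGreatest (fun p : ℕ => ((chainUp t p).reverse).Sublist α) α.length : ℤ)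
  else -1

/-- The Successor Infix Property: between any two equal entries there is an occurrence of
their successor. -/
def SIP (α : List SIdx) : Prop :=
  ∀ a b : Fin α.length, a < b → α.get a = α.get b →
    ∃ c : Fin α.length, a < c ∧ c < b ∧ α.get c = (α.get a).succ

/-- The `mn × mn` elementary matrix `M_k(X)` (viewed as an `m × m` block matrix with
`n × n` blocks): `M_0(X) = M_{−0}(X) = diag(I_{(m−1)n}, X)`,
`M_m(X) = M_{−m}(X) = diag(X, I_{(m−1)n})`, and for `1 ≤ i ≤ m−1` the matrix `M_i(X)`
(resp. `M_{−i}(X)`) is the identity except for the 2×2 block submatrix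
`[[X, I],[I, 0]]` (resp. `[[0, I],[I, X]]`) in block rows/columns `(m−i, m−i+1)`
(1-indexed). -/
noncomputable def elemMat (m n : ℕ) (k : SIdx) (X : Matrix (Fin n) (Fin n) ℂ) :
    Matrix (Fin m × Fin n) (Fin m × Fin n) ℂ := fun p q =>
  if k.val = 0 then
    if p.1 = q.1 then (if (p.1 : ℕ) = m - 1 then X p.2 q.2 else if p.2 = q.2 then 1 else 0)
    else 0
  else if k.val = m then
    if p.1 = q.1 then (if (p.1 : ℕ) = 0 then X p.2 q.2 else if p.2 = q.2 then 1 else 0)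
    else 0
  else
    if (p.1 : ℕ) = m - k.val - 1 ∧ (q.1 : ℕ) = m - k.val - 1 then
      (if k.isNeg then 0 else X p.2 q.2)
    else if ((p.1 : ℕ) = m - k.val - 1 ∧ (q.1 : ℕ) = m - k.val) ∨
        ((p.1 : ℕ) = m - k.val ∧ (q.1 : ℕ) = m - k.val - 1) then
      (if p.2 = q.2 then 1 else 0)
    else if (p.1 : ℕ) = m - k.val ∧ (q.1 : ℕ) = m - k.val then
      (if k.isNeg then X p.2 q.2 else 0)
    else if p = q then 1 else 0

/-- `M_t(X) = M_{t_1}(X_1) ⋯ M_{t_r}(X_r)` for an index tuple `t` with matrix assignment `Xs`. -/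
noncomputable def prodAssign (m n : ℕ) (t : List SIdx) (Xs : List (Matrix (Fin n) (Fin n) ℂ)) :
    Matrix (Fin m × Fin n) (Fin m × Fin n) ℂ :=
  ((t.zip Xs).map fun p => elemMat m n p.1 p.2).prod

/-- The trivial (Fiedler) matrix assignment of `P(λ) = Σ λ^i A_i`:
`M_i^P = M_i(−A_i)` for `0 ≤ i ≤ m−1`, `M_m^P = (M_{−m}^P)⁻¹ = M_m(A_m⁻¹)`,
`M_{−i}^P = M_{−i}(A_i)` for `1 ≤ i ≤ m`, and `M_{−0}^P = (M_0^P)⁻¹ = M_{−0}((−A_0)⁻¹)`. -/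
noncomputable def fiedlerX (m : ℕ) {n : ℕ} (A : ℕ → Matrix (Fin n) (Fin n) ℂ) :
    SIdx → Matrix (Fin n) (Fin n) ℂ
  | .pos i => if i = m then (A m)⁻¹ else -A i
  | .neg i => if i = 0 then (-A 0)⁻¹ else A i

/-- `M_t^P`, the product of Fiedler matrices of `P` along the index tuple `t`. -/
noncomputable def prodFiedler (m n : ℕ) (A : ℕ → Matrix (Fin n) (Fin n) ℂ) (t : List SIdx) :
    Matrix (Fin m × Fin n) (Fin m × Fin n) ℂ :=
  (t.map fun k => elemMat m n k (fiedlerX m A k)).prod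

/-- A nonsingular matrix assignment: the matrices assigned to positions with indices
`±0` or `±m` are nonsingular. -/
def NonsingAssign (m : ℕ) {n : ℕ} (t : List SIdx) (Xs : List (Matrix (Fin n) (Fin n) ℂ)) :
    Prop :=
  t.length = Xs.length ∧ ∀ p ∈ t.zip Xs, (p.1.val = 0 ∨ p.1.val = m) → IsUnit p.2

/-- The data of an extended generalized Fiedler pencil (EGFP)
`L(λ) = M_{τ₁}(Y₁) M_{σ₁}(X₁) (λ M_τ^P − M_σ^P) M_{σ₂}(X₂) M_{τ₂}(Y₂)`
of the `n × n` matrix polynomial `P(λ) = Σ_{i=0}^m λ^i A_i` of degree `m ≥ 2`. -/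
structure EGFPData (m n : ℕ) where
  /-- coefficients of `P` -/
  A : ℕ → Matrix (Fin n) (Fin n) ℂ
  sig : List SIdx
  tau : List SIdx
  sig1 : List SIdx
  sig2 : List SIdx
  tau1 : List SIdx
  tau2 : List SIdx
  X1 : List (Matrix (Fin n) (Fin n) ℂ)
  X2 : List (Matrix (Fin n) (Fin n) ℂ)
  Y1 : List (Matrix (Fin n) (Fin n) ℂ)
  Y2 : List (Matrix (Fin n) (Fin n) ℂ)
  hm : 2 ≤ m
  hAm : A m ≠ 0
  hsigpos : ∀ k ∈ sig, k.isNeg = false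
  htauneg : ∀ k ∈ tau, k.isNeg = true
  /-- `(σ, ω)` is a permutation of `{0, 1, …, m}`, where `τ = −ω`. -/
  hperm : List.Perm (sig.map SIdx.val ++ tau.map SIdx.val) (List.range (m + 1))
  hsig1 : ∀ k ∈ sig1, k ∈ sig ∧ k.val + 2 ≤ m
  hsig2 : ∀ k ∈ sig2, k ∈ sig ∧ k.val + 2 ≤ m
  htau1 : ∀ k ∈ tau1, k ∈ tau ∧ 2 ≤ k.val
  htau2 : ∀ k ∈ tau2, k ∈ tau ∧ 2 ≤ k.val
  hSIPsig : SIP (sig1 ++ sig ++ sig2)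
  hSIPtau : SIP (tau1 ++ tau ++ tau2)
  hX1 : NonsingAssign m sig1 X1
  hX2 : NonsingAssign m sig2 X2
  hY1 : NonsingAssign m tau1 Y1
  hY2 : NonsingAssign m tau2 Y2
  hA0 : SIdx.neg 0 ∈ tau → IsUnit (A 0)
  hAmUnit : SIdx.pos m ∈ sig → IsUnit (A m)

namespace EGFPData

variable {m n : ℕ}

/-- `M_{τ₁}(Y₁) M_{σ₁}(X₁)`. -/
noncomputable def leftFac (E : EGFPData m n) : Matrix (Fin m × Fin n) (Fin m × Fin n) ℂ :=
  prodAssign m n E.tau1 E.Y1 * prodAssign m n E.sig1 E.X1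

/-- `M_{σ₂}(X₂) M_{τ₂}(Y₂)`. -/
noncomputable def rightFac (E : EGFPData m n) : Matrix (Fin m × Fin n) (Fin m × Fin n) ℂ :=
  prodAssign m n E.sig2 E.X2 * prodAssign m n E.tau2 E.Y2

/-- The coefficient `L₁` of `λ` in `L(λ) = λ L₁ − L₀`. -/
noncomputable def L1 (E : EGFPData m n) : Matrix (Fin m × Fin n) (Fin m × Fin n) ℂ :=
  E.leftFac * prodFiedler m n E.A E.tau * E.rightFac

/-- The constant term `L₀` in `L(λ) = λ L₁ − L₀`. -/
noncomputable def L0 (E : EGFPData m n) : Matrix (Fin m × Fin n) (Fin m × Fin n) ℂ :=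
  E.leftFac * prodFiedler m n E.A E.sig * E.rightFac

end EGFPData

/-- The `(i, j)` block (of size `n × n`) of an `mn × mn` matrix. -/
def blockOf {m n : ℕ} (M : Matrix (Fin m × Fin n) (Fin m × Fin n) ℂ) (i j : Fin m) :
    Matrix (Fin n) (Fin n) ℂ := fun p q => M (i, p) (j, q)

/-- Block penta-diagonal: all blocks `B_{ij}` with `|i − j| > 2` vanish. -/
def BlockPenta {m n : ℕ} (M : Matrix (Fin m × Fin n) (Fin m × Fin n) ℂ) : Prop :=
  ∀ i j : Fin m, ((i : ℕ) + 2 < (j : ℕ) ∨ (j : ℕ) + 2 < (i : ℕ)) → blockOf M i j = 0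

/-- Block tridiagonal: all blocks `B_{ij}` with `|i − j| > 1` vanish. -/
def BlockTri {m n : ℕ} (M : Matrix (Fin m × Fin n) (Fin m × Fin n) ℂ) : Prop :=
  ∀ i j : Fin m, ((i : ℕ) + 1 < (j : ℕ) ∨ (j : ℕ) + 1 < (i : ℕ)) → blockOf M i j = 0

/-- `e_j^T ⊗ I_n` as an `n × mn` matrix, for a 1-indexed block index `j`
(zero when `j` is out of range). -/
def rowSel (m n : ℕ) (j : ℤ) : Matrix (Fin n) (Fin m × Fin n) ℂ :=
  fun p q => if ((q.1 : ℕ) : ℤ) + 1 = j ∧ p = q.2 then 1 else 0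

/-- `e_j ⊗ I_n` as an `mn × n` matrix, for a 1-indexed block index `j`
(zero when `j` is out of range). -/
def colSel (m n : ℕ) (j : ℤ) : Matrix (Fin m × Fin n) (Fin n) ℂ :=
  fun p q => if ((p.1 : ℕ) : ℤ) + 1 = j ∧ p.2 = q then 1 else 0

/-- The matrix polynomial `P(λ) = Σ_{i=0}^m λ^i A_i` as an `n × n` matrix over `ℂ[λ]`. -/
noncomputable def polyP (m n : ℕ) (A : ℕ → Matrix (Fin n) (Fin n) ℂ) :
    Matrix (Fin n) (Fin n) (Polynomial ℂ) := fun p q =>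
  ∑ i ∈ Finset.range (m + 1), Polynomial.C (A i p q) * Polynomial.X ^ i

/-- The columns of `Z` form a basis of the right null space `N_r(M)`. -/
def ColsBasisKerRight {α β : Type*} [Fintype β] {k : ℕ} (M : Matrix α β ℂ)
    (Z : Matrix β (Fin k) ℂ) : Prop :=
  (∀ j, M.mulVec (fun i => Z i j) = 0) ∧
  LinearIndependent ℂ (fun j : Fin k => fun i => Z i j) ∧
  ∀ x : β → ℂ, M.mulVec x = 0 →
    x ∈ Submodule.span ℂ (Set.range fun j : Fin k => fun i => Z i j)

/-- The columns of `Z` form a basis of the left null space `N_l(M)`. -/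
def ColsBasisKerLeft {α β : Type*} [Fintype α] {k : ℕ} (M : Matrix α β ℂ)
    (Z : Matrix α (Fin k) ℂ) : Prop :=
  (∀ j, Matrix.vecMul (fun i => Z i j) M = 0) ∧
  LinearIndependent ℂ (fun j : Fin k => fun i => Z i j) ∧
  ∀ y : α → ℂ, Matrix.vecMul y M = 0 →
    y ∈ Submodule.span ℂ (Set.range fun j : Fin k => fun i => Z i j)

set_option linter.all false

namespace EG

variable {m n : ℕ}

/-- wire `w` (0-indexed from the bottom block) of a block vector -/
def W (x : Fin m × Fin n → ℂ) (w : ℕ) : Fin n → ℂ := fun j =>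
  if h : w < m then x (⟨m - 1 - w, by omega⟩, j) else 0

lemma W_ext {x y : Fin m × Fin n → ℂ} (h : ∀ w < m, W x w = W y w) : x = y := by
  funext ⟨i, j⟩
  have h1 := congrFun (h (m - 1 - i) (by omega)) j
  have h2 : m - 1 - i < m := by omega
  simp only [W, h2, dif_pos] at h1
  have h3 : (⟨m - 1 - (m - 1 - (i : ℕ)), by omega⟩ : Fin m) = i := by ext; simp; omega
  rw [h3] at h1
  exact h1

lemma W_surj (f : ℕ → Fin n → ℂ) : ∃ x : Fin m × Fin n → ℂ, ∀ w < m, W x w = f w := by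
  refine ⟨fun p => f (m - 1 - p.1) p.2, fun w hw => ?_⟩
  funext j
  simp only [W, hw, dif_pos]
  congr 1
  omega

lemma W_sub (x y : Fin m × Fin n → ℂ) (w : ℕ) : W (x - y) w = W x w - W y w := by
  funext j
  simp only [W, Pi.sub_apply]
  split_ifs <;> simp

lemma W_smul (c : ℂ) (x : Fin m × Fin n → ℂ) (w : ℕ) : W (c • x) w = c • W x w := by
  funext j
  simp only [W, Pi.smul_apply]
  split_ifs <;> simp

lemma W_zero (w : ℕ) : W (0 : Fin m × Fin n → ℂ) w = 0 := by
  funext j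
  simp [W]

lemma rowSel_mulVec (x : Fin m × Fin n → ℂ) (w : ℕ) (hw : w < m) (j : ℤ) (hj : j = (m : ℤ) - w) :
    (rowSel m n j).mulVec x = W x w := by
  funext a
  simp only [W, hw, dif_pos, Matrix.mulVec, dotProduct, rowSel, Fintype.sum_prod_type]
  rw [Finset.sum_eq_single (⟨m - 1 - w, by omega⟩ : Fin m)]
  · rw [Finset.sum_eq_single a]
    · have : (((m - 1 - w : ℕ) : ℤ) + 1 = j ∧ a = a) := ⟨by omega, rfl⟩
      simp only [this, if_true, and_self, one_mul]
    · intro b _ hb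
      rw [if_neg (fun h => hb h.2.symm), zero_mul]
    · simp
  · intro i _ hi
    apply Finset.sum_eq_zero
    intro b _
    rw [if_neg, zero_mul]
    rintro ⟨h1, -⟩
    apply hi
    ext
    simp only
    omega
  · simp

/-- action of an elementary matrix on wires -/
noncomputable def act (m : ℕ) (k : SIdx) (X : Matrix (Fin n) (Fin n) ℂ) (f : ℕ → Fin n → ℂ) (w : ℕ) :
    Fin n → ℂ :=
  if k.val = 0 then (if w = 0 then X.mulVec (f 0) else f w)
  else if k.val = m then (if w + 1 = m then X.mulVec (f w) else f w)
  else match k with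
  | .pos i => if w = i then X.mulVec (f i) + f (i - 1) else if w + 1 = i then f i else f w
  | .neg i => if w = i then f (i - 1) else if w + 1 = i then f i + X.mulVec (f (i - 1)) else f w

lemma mulVec_two (M : Matrix (Fin m × Fin n) (Fin m × Fin n) ℂ) (x : Fin m × Fin n → ℂ)
    (i j1 j2 : Fin m) (B1 B2 : Matrix (Fin n) (Fin n) ℂ)
    (h : ∀ a j b, M (i, a) (j, b) = (if j = j1 then B1 a b else 0) + (if j = j2 then B2 a b else 0))
    (a : Fin n) :
    M.mulVec x (i, a) = B1.mulVec (fun b => x (j1, b)) a + B2.mulVec (fun b => x (j2, b)) a := by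
  simp only [Matrix.mulVec, dotProduct, Fintype.sum_prod_type, h, add_mul, Finset.sum_add_distrib]
  congr 1
  · rw [Finset.sum_eq_single j1]
    · simp
    · intro j _ hj; simp [hj]
    · simp
  · rw [Finset.sum_eq_single j2]
    · simp
    · intro j _ hj; simp [hj]
    · simp

set_option maxHeartbeats 2000000 in
lemma W_elem (hm : 2 ≤ m) (k : SIdx) (hk : k.val ≤ m) (X : Matrix (Fin n) (Fin n) ℂ)
    (x : Fin m × Fin n → ℂ) (w : ℕ) (hw : w < m) :
    W ((elemMat m n k X).mulVec x) w = act m k X (W x) w := by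
  funext a
  have key : ∀ (w1 w2 : ℕ) (h1 : w1 < m) (h2 : w2 < m) (B1 B2 : Matrix (Fin n) (Fin n) ℂ),
    (∀ a (j : Fin m) b, elemMat m n k X (⟨m - 1 - w, by omega⟩, a) (j, b) =
      (if j = ⟨m - 1 - w1, by omega⟩ then B1 a b else 0) +
      (if j = ⟨m - 1 - w2, by omega⟩ then B2 a b else 0)) →
    W ((elemMat m n k X).mulVec x) w a = (B1.mulVec (W x w1) + B2.mulVec (W x w2)) a := by
    intro w1 w2 h1 h2 B1 B2 h
    have := mulVec_two (elemMat m n k X) x ⟨m - 1 - w, by omega⟩ ⟨m - 1 - w1, by omega⟩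
      ⟨m - 1 - w2, by omega⟩ B1 B2 h a
    have e1 : W x w1 = fun b => x (⟨m - 1 - w1, by omega⟩, b) := by
      funext b; simp only [W, h1, dif_pos]
    have e2 : W x w2 = fun b => x (⟨m - 1 - w2, by omega⟩, b) := by
      funext b; simp only [W, h2, dif_pos]
    rw [e1, e2, Pi.add_apply, ← this]
    simp only [W, hw, dif_pos]
  have idk : ∀ a b, (1 : Matrix (Fin n) (Fin n) ℂ) a b = if a = b then 1 else 0 :=
    fun a b => Matrix.one_apply
  rcases k with i | i <;> simp only [SIdx.val] at hk
  · by_cases h0 : i = 0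
    · by_cases hw0 : w = 0
      · rw [key w w hw hw X 0]
        · simp [act, SIdx.val, h0, hw0]
        · intro a j b
          simp only [elemMat, SIdx.val, h0, Fin.ext_iff, idk, Matrix.zero_apply]
          split_ifs <;> first | omega | simp
      · rw [key w w hw hw 1 0]
        · simp [act, SIdx.val, h0, hw0]
        · intro a j b
          simp only [elemMat, SIdx.val, h0, Fin.ext_iff, idk, Matrix.zero_apply]
          split_ifs <;> first | omega | simp
    · by_cases hm' : i = m
      · by_cases hw0 : w + 1 = m
        · rw [key w w hw hw X 0]
          · simp [act, SIdx.val, h0, hw0, hm', show m ≠ 0 by omega]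
          · intro a j b
            simp only [elemMat, SIdx.val, hm', Fin.ext_iff, idk, Matrix.zero_apply]
            split_ifs <;> first | omega | simp
        · rw [key w w hw hw 1 0]
          · simp [act, SIdx.val, h0, hw0, hm', show m ≠ 0 by omega]
          · intro a j b
            simp only [elemMat, SIdx.val, hm', Fin.ext_iff, idk, Matrix.zero_apply]
            split_ifs <;> first | omega | simp
      · by_cases hw0 : w = i
        · rw [key i (i - 1) (by omega) (by omega) X 1]
          · simp [act, SIdx.val, h0, hw0, hm']
          · intro a j b
            simp only [elemMat, SIdx.val, SIdx.isNeg, Bool.false_eq_true, if_false, if_true, Fin.ext_iff, Prod.ext_iff, idk, Matrix.zero_apply]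
            split_ifs <;> first | omega | simp
        · by_cases hw1 : w + 1 = i
          · rw [key i i (by omega) (by omega) 1 0]
            · simp [act, SIdx.val, h0, hw0, hm', hw1]
            · intro a j b
              simp only [elemMat, SIdx.val, SIdx.isNeg, Bool.false_eq_true, if_false, if_true, Fin.ext_iff, Prod.ext_iff, idk, Matrix.zero_apply]
              split_ifs <;> first | omega | simp
          · rw [key w w (by omega) (by omega) 1 0]
            · simp [act, SIdx.val, h0, hw0, hm', hw1]
            · intro a j b
              simp only [elemMat, SIdx.val, SIdx.isNeg, Bool.false_eq_true, if_false, if_true, Fin.ext_iff, Prod.ext_iff, idk, Matrix.zero_apply]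
              split_ifs <;> first | omega | simp
  · by_cases h0 : i = 0
    · by_cases hw0 : w = 0
      · rw [key w w hw hw X 0]
        · simp [act, SIdx.val, h0, hw0]
        · intro a j b
          simp only [elemMat, SIdx.val, h0, Fin.ext_iff, idk, Matrix.zero_apply]
          split_ifs <;> first | omega | simp
      · rw [key w w hw hw 1 0]
        · simp [act, SIdx.val, h0, hw0]
        · intro a j b
          simp only [elemMat, SIdx.val, h0, Fin.ext_iff, idk, Matrix.zero_apply]
          split_ifs <;> first | omega | simp
    · by_cases hm' : i = m
      · by_cases hw0 : w + 1 = m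
        · rw [key w w hw hw X 0]
          · simp [act, SIdx.val, h0, hw0, hm', show m ≠ 0 by omega]
          · intro a j b
            simp only [elemMat, SIdx.val, hm', Fin.ext_iff, idk, Matrix.zero_apply]
            split_ifs <;> first | omega | simp
        · rw [key w w hw hw 1 0]
          · simp [act, SIdx.val, h0, hw0, hm', show m ≠ 0 by omega]
          · intro a j b
            simp only [elemMat, SIdx.val, hm', Fin.ext_iff, idk, Matrix.zero_apply]
            split_ifs <;> first | omega | simp
      · by_cases hw0 : w = i
        · rw [key (i - 1) (i - 1) (by omega) (by omega) 1 0]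
          · simp [act, SIdx.val, h0, hw0, hm']
          · intro a j b
            simp only [elemMat, SIdx.val, SIdx.isNeg, Bool.false_eq_true, if_false, if_true, Fin.ext_iff, Prod.ext_iff, idk, Matrix.zero_apply]
            split_ifs <;> first | omega | simp
        · by_cases hw1 : w + 1 = i
          · rw [key i (i - 1) (by omega) (by omega) 1 X]
            · simp [act, SIdx.val, h0, hw0, hm', hw1]
            · intro a j b
              simp only [elemMat, SIdx.val, SIdx.isNeg, Bool.false_eq_true, if_false, if_true, Fin.ext_iff, Prod.ext_iff, idk, Matrix.zero_apply]
              split_ifs <;> first | omega | simp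
          · rw [key w w (by omega) (by omega) 1 0]
            · simp [act, SIdx.val, h0, hw0, hm', hw1]
            · intro a j b
              simp only [elemMat, SIdx.val, SIdx.isNeg, Bool.false_eq_true, if_false, if_true, Fin.ext_iff, Prod.ext_iff, idk, Matrix.zero_apply]
              split_ifs <;> first | omega | simp

end EG
namespace EG

variable {m n : ℕ}

abbrev Mt (n : ℕ) := Matrix (Fin n) (Fin n) ℂ
abbrev Sq (n : ℕ) := ℕ → Fin n → ℂ

def touch (k : SIdx) (w : ℕ) : Prop := k.val = w ∨ k.val = w + 1

instance (k : SIdx) (w : ℕ) : Decidable (touch k w) := by unfold touch; infer_instance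

def inn (u p q : Sq n) (k : SIdx) (w : ℕ) : Fin n → ℂ :=
  match k with
  | .pos i => if i = w then u i else q i
  | .neg i => if i = w then p i else u i

def out (u p q : Sq n) (k : SIdx) (w : ℕ) : Fin n → ℂ :=
  match k with
  | .pos i => if i = w then p i else u i
  | .neg i => if i = w then u i else q i

/-- gate relation -/
def GR (m : ℕ) (k : SIdx) (X : Mt n) (u p q : Sq n) : Prop :=
  match k with
  | .pos i => if i = 0 then p i = X.mulVec (u i) ∧ q i = 0
      else if i = m then u i = X.mulVec (q i) ∧ p i = 0
      else p i = X.mulVec (u i) + q i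
  | .neg i => if i = 0 then u i = X.mulVec (p i) ∧ q i = 0
      else if i = m then q i = X.mulVec (u i) ∧ p i = 0
      else q i = p i + X.mulVec (u i)

lemma act_gate (hm : 2 ≤ m) (k : SIdx) (hk : k.val ≤ m) (X : Mt n) (u p q : Sq n) (f : Sq n)
    (hf : ∀ w < m, touch k w → f w = inn u p q k w) (hg : GR m k X u p q) (w : ℕ) (hw : w < m) :
    act m k X f w = if touch k w then out u p q k w else f w := by
  rcases k with i | i <;> simp only [SIdx.val] at hk
  · simp only [GR] at hg
    simp only [touch, SIdx.val, inn] at hf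
    simp only [act, SIdx.val, touch, out]
    by_cases h0 : i = 0
    · subst h0
      have := hf 0 (by omega) (Or.inl rfl)
      by_cases hw0 : w = 0
      · subst hw0; simp_all
      · simp_all [eq_comm]
    · by_cases h1 : i = m
      · subst h1
        by_cases hw0 : w + 1 = i
        · subst hw0
          have := hf w (by omega) (Or.inr rfl)
          simp_all
        · have : i ≠ w := by omega
          have : i ≠ w + 1 := by omega
          simp_all
      · simp only [h0, h1, if_false] at hg ⊢
        have a1 := hf i (by omega) (Or.inl rfl)
        have a2 := hf (i - 1) (by omega) (Or.inr (by omega))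
        rw [if_pos rfl] at a1
        rw [if_neg (by omega)] at a2
        by_cases hw0 : w = i
        · subst hw0; simp [a1, a2, hg]
        · by_cases hw1 : w + 1 = i
          · have : ¬ i = w := by omega
            simp [hw0, hw1, a1, this]
          · have : ¬ i = w := by omega
            have : ¬ i = w + 1 := by omega
            simp [*]
  · simp only [GR] at hg
    simp only [touch, SIdx.val, inn] at hf
    simp only [act, SIdx.val, touch, out]
    by_cases h0 : i = 0
    · subst h0
      have := hf 0 (by omega) (Or.inl rfl)
      by_cases hw0 : w = 0
      · subst hw0; simp_all
      · simp_all [eq_comm]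
    · by_cases h1 : i = m
      · subst h1
        by_cases hw0 : w + 1 = i
        · subst hw0
          have := hf w (by omega) (Or.inr rfl)
          simp_all
        · have : i ≠ w := by omega
          have : i ≠ w + 1 := by omega
          simp_all
      · simp only [h0, h1, if_false] at hg ⊢
        have a1 := hf i (by omega) (Or.inl rfl)
        have a2 := hf (i - 1) (by omega) (Or.inr (by omega))
        rw [if_pos rfl] at a1
        rw [if_neg (by omega)] at a2
        by_cases hw0 : w = i
        · subst hw0; simp [a1, a2, hg]
        · by_cases hw1 : w + 1 = i
          · have : ¬ i = w := by omega
            simp [hw0, hw1, a1, a2, hg, this]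
          · have : ¬ i = w := by omega
            have : ¬ i = w + 1 := by omega
            simp [*]

lemma exist_gate (hm : 2 ≤ m) (k : SIdx) (hk : k.val ≤ m) (X : Mt n) (f : Sq n) :
    ∃ a b c : Fin n → ℂ, ∀ u p q : Sq n, u k.val = a → p k.val = b → q k.val = c →
      GR m k X u p q ∧ ∀ w < m, touch k w → f w = inn u p q k w := by
  rcases k with i | i <;> simp only [SIdx.val] at hk
  · by_cases h0 : i = 0
    · refine ⟨f 0, X.mulVec (f 0), 0, fun u p q hu hp hq => ⟨?_, ?_⟩⟩
      · simp only [SIdx.val] at hu hp hq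
        simp [GR, h0]; subst h0; simp [hu, hp, hq]
      · intro w hw ht
        simp only [touch, SIdx.val, inn] at *
        have : i = w := by omega
        rw [if_pos this, hu]; congr 1; omega
    · by_cases h1 : i = m
      · refine ⟨X.mulVec (f (m-1)), 0, f (m - 1), fun u p q hu hp hq => ⟨?_, ?_⟩⟩
        · simp only [SIdx.val] at hu hp hq
          simp [GR, h0, h1]; subst h1; simp [hu, hp, hq, h0]
        · intro w hw ht
          simp only [touch, SIdx.val, inn] at *
          have : ¬ i = w := by omega
          rw [if_neg this, hq]; congr 1; omega
      · refine ⟨f i, X.mulVec (f i) + f (i - 1), f (i-1), fun u p q hu hp hq => ⟨?_, ?_⟩⟩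
        · simp only [SIdx.val] at hu hp hq
          simp [GR, h0, h1, hu, hp, hq]
        · intro w hw ht
          simp only [touch, SIdx.val, inn] at *
          by_cases h : i = w
          · rw [if_pos h, hu, h]
          · rw [if_neg h, hq]; congr 1; omega
  · by_cases h0 : i = 0
    · refine ⟨X.mulVec (f 0), f 0, 0, fun u p q hu hp hq => ⟨?_, ?_⟩⟩
      · simp only [SIdx.val] at hu hp hq
        simp [GR, h0]; subst h0; simp [hu, hp, hq]
      · intro w hw ht
        simp only [touch, SIdx.val, inn] at *
        have : i = w := by omega
        rw [if_pos this, hp]; congr 1; omega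
    · by_cases h1 : i = m
      · refine ⟨f (m - 1), 0, X.mulVec (f (m-1)), fun u p q hu hp hq => ⟨?_, ?_⟩⟩
        · simp only [SIdx.val] at hu hp hq
          simp [GR, h0, h1]; subst h1; simp [hu, hp, hq, h0]
        · intro w hw ht
          simp only [touch, SIdx.val, inn] at *
          have : ¬ i = w := by omega
          rw [if_neg this, hu]; congr 1; omega
      · refine ⟨f (i-1), f i, f i + X.mulVec (f (i-1)), fun u p q hu hp hq => ⟨?_, ?_⟩⟩
        · simp only [SIdx.val] at hu hp hq
          simp [GR, h0, h1, hu, hp, hq]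
        · intro w hw ht
          simp only [touch, SIdx.val, inn] at *
          by_cases h : i = w
          · rw [if_pos h, hp, h]
          · rw [if_neg h, hu]; congr 1; omega

def Link (u p q : Sq n) : List SIdx → ℕ → (Fin n → ℂ) → (Fin n → ℂ) → Prop
  | [], _, x, y => y = x
  | k :: t, w, x, y =>
      if touch k w then Link u p q t w x (inn u p q k w) ∧ y = out u p q k w
      else Link u p q t w x y

lemma Link_filter (u p q : Sq n) (t : List SIdx) (w : ℕ) (x y : Fin n → ℂ) :
    Link u p q t w x y ↔ Link u p q (t.filter (fun k => touch k w)) w x y := by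
  induction t generalizing y with
  | nil => rfl
  | cons k t ih =>
    by_cases h : touch k w
    · rw [List.filter_cons_of_pos (by simpa using h)]
      simp only [Link, h, if_true]
      rw [ih]
    · rw [List.filter_cons_of_neg (by simpa using h)]
      simp only [Link, h, if_false]
      rw [ih]

lemma GR_congr {k : SIdx} {X : Mt n} {u p q u' p' q' : Sq n} (h1 : u k.val = u' k.val)
    (h2 : p k.val = p' k.val) (h3 : q k.val = q' k.val) :
    GR m k X u p q ↔ GR m k X u' p' q' := by
  rcases k with i | i <;> simp only [SIdx.val] at h1 h2 h3 <;> simp only [GR, h1, h2, h3]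

lemma inn_congr {k : SIdx} {u p q u' p' q' : Sq n} (h1 : u k.val = u' k.val)
    (h2 : p k.val = p' k.val) (h3 : q k.val = q' k.val) (w : ℕ) :
    inn u p q k w = inn u' p' q' k w := by
  rcases k with i | i <;> simp only [SIdx.val] at h1 h2 h3 <;> simp only [inn, h1, h2, h3]

lemma out_congr {k : SIdx} {u p q u' p' q' : Sq n} (h1 : u k.val = u' k.val)
    (h2 : p k.val = p' k.val) (h3 : q k.val = q' k.val) (w : ℕ) :
    out u p q k w = out u' p' q' k w := by
  rcases k with i | i <;> simp only [SIdx.val] at h1 h2 h3 <;> simp only [out, h1, h2, h3]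

lemma Link_congr {u p q u' p' q' : Sq n} (t : List SIdx)
    (h : ∀ k ∈ t, u k.val = u' k.val ∧ p k.val = p' k.val ∧ q k.val = q' k.val) (w : ℕ)
    (x y : Fin n → ℂ) : Link u p q t w x y ↔ Link u' p' q' t w x y := by
  induction t generalizing y with
  | nil => rfl
  | cons k t ih =>
    obtain ⟨h1, h2, h3⟩ := h k (by simp)
    simp only [Link]
    rw [inn_congr h1 h2 h3 w, out_congr h1 h2 h3 w, ih (fun k hk => h k (by simp [hk])),
      ih (fun k hk => h k (by simp [hk]))]

noncomputable def bigProd (m : ℕ) (z : List (SIdx × Mt n)) :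
    Matrix (Fin m × Fin n) (Fin m × Fin n) ℂ :=
  (z.map fun p => elemMat m n p.1 p.2).prod

lemma bigProd_cons (a : SIdx × Mt n) (z : List (SIdx × Mt n)) (x : Fin m × Fin n → ℂ) :
    (bigProd m (a :: z)).mulVec x = (elemMat m n a.1 a.2).mulVec ((bigProd m z).mulVec x) := by
  simp [bigProd, Matrix.mulVec_mulVec]

lemma bigProd_nil (x : Fin m × Fin n → ℂ) :
    (bigProd m ([] : List (SIdx × Mt n))).mulVec x = x := by
  simp [bigProd]

lemma claimA (hm : 2 ≤ m) (u p q : Sq n) (x : Fin m × Fin n → ℂ) (z : List (SIdx × Mt n))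
    (hz : ∀ a ∈ z, a.1.val ≤ m ∧ GR m a.1 a.2 u p q) (f : Sq n)
    (hl : ∀ w < m, Link u p q (z.map Prod.fst) w (W x w) (f w)) :
    ∀ w < m, W ((bigProd m z).mulVec x) w = f w := by
  induction z generalizing f with
  | nil =>
    intro w hw
    rw [bigProd_nil]
    exact (hl w hw).symm
  | cons a z ih =>
    intro w hw
    have ih' := ih (fun b hb => hz b (by simp [hb]))
      (fun w => if touch a.1 w then inn u p q a.1 w else f w) (by
        intro w hw
        have := hl w hw
        simp only [List.map_cons, Link] at this
        by_cases ht : touch a.1 w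
        · simp only [ht, if_true] at this ⊢
          exact this.1
        · simp only [ht, if_false] at this ⊢
          exact this)
    obtain ⟨h1, h2⟩ := hz a (by simp)
    rw [bigProd_cons, W_elem hm _ h1 _ _ _ hw, act_gate hm a.1 h1 a.2 u p q _ _ h2 w hw]
    · have := hl w hw
      simp only [List.map_cons, Link] at this
      by_cases ht : touch a.1 w
      · simp only [ht, if_true] at this ⊢
        exact this.2.symm
      · simp only [ht, if_false] at this ⊢
        rw [ih' w hw, if_neg ht]
    · intro w hw ht
      rw [ih' w hw, if_pos ht]

lemma claimB (hm : 2 ≤ m) (x : Fin m × Fin n → ℂ) (z : List (SIdx × Mt n))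
    (hz : ∀ a ∈ z, a.1.val ≤ m) (hnd : (z.map (fun a => a.1.val)).Nodup) (u p q : Sq n) :
    ∃ u' p' q' : Sq n,
      (∀ i, i ∉ z.map (fun a => a.1.val) → u' i = u i ∧ p' i = p i ∧ q' i = q i) ∧
      (∀ a ∈ z, GR m a.1 a.2 u' p' q') ∧
      ∀ w < m, Link u' p' q' (z.map Prod.fst) w (W x w) (W ((bigProd m z).mulVec x) w) := by
  induction z with
  | nil =>
    refine ⟨u, p, q, fun _ _ => ⟨rfl, rfl, rfl⟩, by simp, ?_⟩
    intro w hw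
    simp [Link, bigProd_nil]
  | cons a z ih =>
    simp only [List.map_cons, List.nodup_cons] at hnd
    obtain ⟨u1, p1, q1, ha, hg, hl⟩ := ih (fun b hb => hz b (by simp [hb])) hnd.2
    have hka := hz a (by simp)
    obtain ⟨A, B, C, hABC⟩ := exist_gate hm a.1 hka a.2 (W ((bigProd m z).mulVec x))
    have hag : ∀ k : SIdx, k.val ≠ a.1.val →
      u1 k.val = Function.update u1 a.1.val A k.val ∧
      p1 k.val = Function.update p1 a.1.val B k.val ∧
      q1 k.val = Function.update q1 a.1.val C k.val := by
      intro k hk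
      simp [Function.update_of_ne hk]
    have hne : ∀ b ∈ z, b.1.val ≠ a.1.val := by
      intro b hb hba
      apply hnd.1
      rw [List.mem_map]
      exact ⟨b, hb, hba⟩
    refine ⟨Function.update u1 a.1.val A, Function.update p1 a.1.val B,
      Function.update q1 a.1.val C, ?_, ?_, ?_⟩
    · intro i hi
      simp only [List.map_cons, List.mem_cons, not_or] at hi
      simp only [Function.update_of_ne hi.1]
      exact ha i hi.2
    · intro b hb
      rcases List.mem_cons.1 hb with rfl | hb
      · exact (hABC _ _ _ (by simp) (by simp) (by simp)).1
      · obtain ⟨h1, h2, h3⟩ := hag b.1 (hne b hb)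
        exact (GR_congr h1 h2 h3).1 (hg b hb)
    · intro w hw
      obtain ⟨g1, g2⟩ := hABC (Function.update u1 a.1.val A) (Function.update p1 a.1.val B)
        (Function.update q1 a.1.val C) (by simp) (by simp) (by simp)
      rw [bigProd_cons, W_elem hm _ hka _ _ _ hw, act_gate hm a.1 hka a.2 _ _ _ _ g2 g1 w hw]
      have hl' := (Link_congr (u' := Function.update u1 a.1.val A)
        (p' := Function.update p1 a.1.val B) (q' := Function.update q1 a.1.val C)
        (z.map Prod.fst) (by
          intro k hk
          obtain ⟨b, hb, rfl⟩ := List.mem_map.1 hk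
          exact hag b.1 (hne b hb)) w _ _).1 (hl w hw)
      simp only [List.map_cons, Link]
      by_cases ht : touch a.1 w
      · simp only [ht, if_true, and_true]
        rw [← g2 w hw ht]
        exact hl'
      · simp only [ht, if_false]
        exact hl'

end EG
namespace EG

variable {m n : ℕ}

/-- list form of the successor infix property -/
def SIPL (α : List SIdx) : Prop :=
  ∀ l1 a l2 l3, α = l1 ++ a :: (l2 ++ a :: l3) → a.succ ∈ l2

structure RH (m : ℕ) (sig tau sig2 tau2 : List SIdx) : Prop where
  hm : 2 ≤ m
  hpos : ∀ k ∈ sig, ∃ i, k = .pos i ∧ i ≤ m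
  hneg : ∀ k ∈ tau, ∃ i, k = .neg i ∧ i ≤ m
  cover : ∀ i ≤ m, .pos i ∈ sig ∨ .neg i ∈ tau
  disj : ∀ i, .pos i ∈ sig → .neg i ∉ tau
  nds : (sig.map SIdx.val).Nodup
  ndt : (tau.map SIdx.val).Nodup
  hs2 : ∀ k ∈ sig2, k ∈ sig ∧ k.val + 2 ≤ m
  ht2 : ∀ k ∈ tau2, k ∈ tau ∧ 2 ≤ k.val
  sips : SIPL (sig ++ sig2)
  sipt : SIPL (tau ++ tau2)

inductive Kd where
  | k1 | k2 | k3 | k4 | k5 | k6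

def Kd.lists (w : ℕ) : Kd → List SIdx × List SIdx
  | .k1 => ([.pos w, .pos (w+1)], [])
  | .k2 => ([.pos (w+1), .pos w], [])
  | .k3 => ([.pos w], [.neg (w+1)])
  | .k4 => ([.pos (w+1)], [.neg w])
  | .k5 => ([], [.neg (w+1), .neg w])
  | .k6 => ([], [.neg w, .neg (w+1)])

def Kd.isS : Kd → Bool
  | .k1 => true
  | .k2 => false
  | .k3 => true
  | .k4 => false
  | .k5 => true
  | .k6 => false

def Kd.sel (u p q : Sq n) (w : ℕ) : Kd → Fin n → ℂ
  | .k1 => q (w+1)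
  | .k2 => u w
  | .k3 => u w
  | .k4 => p w
  | .k5 => p w
  | .k6 => u (w+1)

def HasKind (sig tau : List SIdx) (w : ℕ) (κ : Kd) : Prop :=
  (sig.filter (fun k => touch k w), tau.filter (fun k => touch k w)) = κ.lists w

lemma two_list {a b : SIdx} (l : List SIdx) (hnd : l.Nodup) (h : ∀ k ∈ l, k = a ∨ k = b) :
    l = [] ∨ l = [a] ∨ l = [b] ∨ l = [a, b] ∨ l = [b, a] := by
  match l, hnd, h with
  | [], _, _ => simp
  | [x], _, h => have := h x (by simp); rcases this with rfl | rfl <;> simp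
  | [x, y], hnd, h =>
    have h1 := h x (by simp)
    have h2 := h y (by simp)
    simp at hnd
    rcases h1 with rfl | rfl <;> rcases h2 with rfl | rfl <;> simp_all
  | x :: y :: z :: t, hnd, h =>
    exfalso
    have h1 := h x (by simp)
    have h2 := h y (by simp)
    have h3 := h z (by simp)
    simp at hnd
    rcases h1 with rfl | rfl <;> rcases h2 with rfl | rfl <;> rcases h3 with rfl | rfl <;> simp_all

lemma exists_kind {sig tau sig2 tau2 : List SIdx} (H : RH m sig tau sig2 tau2) (w : ℕ)
    (hw : w < m) : ∃ κ, HasKind sig tau w κ := by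
  have n1 : sig.Nodup := H.nds.of_map
  have n2 : tau.Nodup := H.ndt.of_map
  have s := two_list (a := .pos w) (b := .pos (w+1)) (sig.filter (fun k => touch k w))
    (n1.filter _) (by
      intro k hk
      rw [List.mem_filter] at hk
      obtain ⟨i, rfl, _⟩ := H.hpos k hk.1
      have := of_decide_eq_true hk.2
      simpa [touch, SIdx.val] using this)
  have t := two_list (a := .neg w) (b := .neg (w+1)) (tau.filter (fun k => touch k w))
    (n2.filter _) (by
      intro k hk
      rw [List.mem_filter] at hk
      obtain ⟨i, rfl, _⟩ := H.hneg k hk.1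
      have := of_decide_eq_true hk.2
      simpa [touch, SIdx.val] using this)
  have e1 : ∀ i, (i = w ∨ i = w + 1) →
      (SIdx.pos i ∈ sig.filter (fun k => touch k w) ↔ SIdx.pos i ∈ sig) := by
    intro i hi
    rw [List.mem_filter]
    exact ⟨fun h => h.1, fun h => ⟨h, decide_eq_true hi⟩⟩
  have e2 : ∀ i, (i = w ∨ i = w + 1) →
      (SIdx.neg i ∈ tau.filter (fun k => touch k w) ↔ SIdx.neg i ∈ tau) := by
    intro i hi
    rw [List.mem_filter]
    exact ⟨fun h => h.1, fun h => ⟨h, decide_eq_true hi⟩⟩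
  have c1 := H.cover w (by omega)
  have c2 := H.cover (w+1) (by omega)
  have d1 := H.disj w
  have d2 := H.disj (w+1)
  rw [← e1 w (by simp), ← e2 w (by simp)] at c1 d1
  rw [← e1 (w+1) (by simp), ← e2 (w+1) (by simp)] at c2 d2
  unfold HasKind
  rcases s with s | s | s | s | s <;> rcases t with t | t | t | t | t <;>
    rw [s, t] at c1 d1 c2 d2 <;> simp at c1 d1 c2 d2 <;> rw [s, t]
  · exact ⟨.k6, rfl⟩
  · exact ⟨.k5, rfl⟩
  · exact ⟨.k3, rfl⟩
  · exact ⟨.k4, rfl⟩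
  · exact ⟨.k1, rfl⟩
  · exact ⟨.k2, rfl⟩

lemma link_kind {sig tau : List SIdx} {w : ℕ} {κ : Kd} (hκ : HasKind sig tau w κ) (μ : ℂ)
    (u p q : Sq n) (x : Fin n → ℂ) :
    (∃ y, Link u p q tau w x y ∧ Link u p q sig w x (μ • y)) ↔
      (if κ.isS then u (w+1) = u w ∧ p w = μ • q (w+1) else u (w+1) = μ • u w ∧ p w = q (w+1)) ∧
      x = κ.sel u p q w := by
  simp only [HasKind] at hκ
  have hs := congrArg Prod.fst hκ
  have ht := congrArg Prod.snd hκ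
  simp only at hs ht
  simp only [Link_filter u p q sig w, Link_filter u p q tau w]
  rw [hs, ht]
  cases κ <;> simp [Kd.lists, Kd.isS, Kd.sel, Link, touch, SIdx.val, inn, out] <;>
  constructor <;> grind

/-- Solutions of the linearised chain system. -/
structure Sol (m : ℕ) (A : ℕ → Mt n) (μ : ℂ) (S : ℕ → Bool) (u p q : Sq n) : Prop where
  q0 : q 0 = 0
  pm : p m = 0
  gate : ∀ i ≤ m, q i = p i + (A i).mulVec (u i)
  linkS : ∀ i < m, S i = true → u (i+1) = u i ∧ p i = μ • q (i+1)
  linkM : ∀ i < m, S i = false → u (i+1) = μ • u i ∧ p i = q (i+1)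

noncomputable def Pol (m : ℕ) (A : ℕ → Mt n) (μ : ℂ) : Mt n :=
  ∑ i ∈ Finset.range (m + 1), μ ^ i • A i

lemma sol_sum {A : ℕ → Mt n} {μ : ℂ} {S : ℕ → Bool} {u p q : Sq n}
    (pm : p m = 0) (gate : ∀ i ≤ m, q i = p i + (A i).mulVec (u i))
    (linkS : ∀ i < m, S i = true → u (i+1) = u i ∧ p i = μ • q (i+1))
    (linkM : ∀ i < m, S i = false → u (i+1) = μ • u i ∧ p i = q (i+1)) :
    (Pol m A μ).mulVec (u 0) = q 0 := by
  have key : ∀ i ≤ m, ∃ k s, k + s = i ∧ u i = μ ^ k • u 0 ∧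
      (∑ j ∈ Finset.range i, μ ^ j • A j).mulVec (u 0) + μ ^ s • q i = q 0 := by
    intro i
    induction i with
    | zero => intro _; exact ⟨0, 0, rfl, by simp, by simp⟩
    | succ i ih =>
      intro hi
      obtain ⟨k, s, hks, hu, hq⟩ := ih (by omega)
      have hA : μ ^ s • (A i).mulVec (u i) = (μ ^ i • A i).mulVec (u 0) := by
        rw [hu, Matrix.mulVec_smul, smul_smul, Matrix.smul_mulVec, ← pow_add]
        congr 2; omega
      rw [gate i (by omega), smul_add, hA] at hq
      cases hS : S i
      · obtain ⟨h1, h2⟩ := linkM i (by omega) hS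
        refine ⟨k+1, s, by omega, by rw [h1, hu, smul_smul, pow_succ']  , ?_⟩
        rw [Finset.sum_range_succ, Matrix.add_mulVec, ← hq, h2]
        abel
      · obtain ⟨h1, h2⟩ := linkS i (by omega) hS
        refine ⟨k, s+1, by omega, by rw [h1, hu], ?_⟩
        rw [Finset.sum_range_succ, Matrix.add_mulVec, ← hq, h2, smul_smul, ← pow_succ]
        abel
  obtain ⟨k, s, hks, hu, hq⟩ := key m le_rfl
  rw [gate m le_rfl, pm, zero_add, hu, Matrix.mulVec_smul, smul_smul, ← pow_add,
    ← Matrix.smul_mulVec, ← Matrix.add_mulVec] at hq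
  rw [← hq, Pol, Finset.sum_range_succ, add_comm s k, hks]

lemma Sol.poly {A : ℕ → Mt n} {μ : ℂ} {S : ℕ → Bool} {u p q : Sq n} (h : Sol m A μ S u p q) :
    (Pol m A μ).mulVec (u 0) = 0 := by
  rw [sol_sum h.pm h.gate h.linkS h.linkM, h.q0]

lemma Sol.zero {A : ℕ → Mt n} {μ : ℂ} {S : ℕ → Bool} {u p q : Sq n} (h : Sol m A μ S u p q)
    (h0 : u 0 = 0) : ∀ i ≤ m, u i = 0 ∧ p i = 0 ∧ q i = 0 := by
  have hu : ∀ i ≤ m, u i = 0 := by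
    intro i
    induction i with
    | zero => intro _; exact h0
    | succ i ih =>
      intro hi
      have := ih (by omega)
      cases hS : S i
      · rw [(h.linkM i (by omega) hS).1, this, smul_zero]
      · rw [(h.linkS i (by omega) hS).1, this]
  have hp : ∀ d i, i + d = m → p i = 0 := by
    intro d
    induction d with
    | zero => intro i hi; have : i = m := by omega
              rw [this, h.pm]
    | succ d ih =>
      intro i hi
      have h1 := ih (i+1) (by omega)
      have h2 := h.gate (i+1) (by omega)
      rw [h1, hu _ (by omega), Matrix.mulVec_zero, add_zero] at h2
      cases hS : S i
      · rw [(h.linkM i (by omega) hS).2, h2]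
      · rw [(h.linkS i (by omega) hS).2, h2, smul_zero]
  intro i hi
  have h1 := hp (m - i) i (by omega)
  refine ⟨hu i hi, h1, ?_⟩
  rw [h.gate i hi, h1, hu i hi, Matrix.mulVec_zero, add_zero]

lemma Sol.exists (A : ℕ → Mt n) (μ : ℂ) (S : ℕ → Bool) (z : Fin n → ℂ)
    (hz : (Pol m A μ).mulVec z = 0) : ∃ u p q : Sq n, Sol m A μ S u p q ∧ u 0 = z := by
  let u : Sq n := fun i => Nat.rec z (fun i v => if S i then v else μ • v) i
  have hus : ∀ i, u (i+1) = if S i then u i else μ • u i := fun i => rfl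
  let r : ℕ → Fin n → ℂ := fun d => Nat.rec ((A m).mulVec (u m)) (fun d v =>
    (if S (m - (d+1)) then μ • v else v) + (A (m - (d+1))).mulVec (u (m - (d+1)))) d
  have hr : ∀ d, r (d+1) = (if S (m - (d+1)) then μ • r d else r d) +
    (A (m - (d+1))).mulVec (u (m - (d+1))) := fun d => rfl
  let q : Sq n := fun i => r (m - i)
  let p : Sq n := fun i => if i < m then (if S i then μ • q (i+1) else q (i+1)) else 0
  have pm : p m = 0 := by simp [p]
  have gate : ∀ i ≤ m, q i = p i + (A i).mulVec (u i) := by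
    intro i hi
    by_cases h : i < m
    · have h1 : m - i = (m - (i+1)) + 1 := by omega
      have h2 : m - (m - (i + 1) + 1) = i := by omega
      simp only [q, p, h, if_true]
      rw [h1, hr, h2]
    · have : i = m := by omega
      subst this
      simp only [q, p, h, if_false, zero_add, Nat.sub_self]
      rfl
  have linkS : ∀ i < m, S i = true → u (i+1) = u i ∧ p i = μ • q (i+1) := by
    intro i hi hS
    refine ⟨by rw [hus, if_pos hS], by simp [p, hi, hS]⟩
  have linkM : ∀ i < m, S i = false → u (i+1) = μ • u i ∧ p i = q (i+1) := by
    intro i hi hS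
    refine ⟨by rw [hus, hS]; simp, by simp [p, hi, hS]⟩
  refine ⟨u, p, q, ⟨?_, pm, gate, linkS, linkM⟩, rfl⟩
  rw [← sol_sum pm gate linkS linkM]
  exact hz

/-- Fiedler data as a list of pairs -/
noncomputable def fz (m : ℕ) (A : ℕ → Mt n) (t : List SIdx) : List (SIdx × Mt n) :=
  t.map fun k => (k, fiedlerX m A k)

lemma prodFiedler_eq (A : ℕ → Mt n) (t : List SIdx) :
    prodFiedler m n A t = bigProd m (fz m A t) := by
  simp [prodFiedler, bigProd, fz, Function.comp_def]

lemma mulVec_inv_iff {B : Mt n} (h : IsUnit B) (a b : Fin n → ℂ) :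
    a = (B⁻¹).mulVec b ↔ b = B.mulVec a := by
  have hd : IsUnit B.det := (Matrix.isUnit_iff_isUnit_det B).1 h
  constructor
  · rintro rfl
    rw [Matrix.mulVec_mulVec, Matrix.mul_nonsing_inv _ hd, Matrix.one_mulVec]
  · rintro rfl
    rw [Matrix.mulVec_mulVec, Matrix.nonsing_inv_mul _ hd, Matrix.one_mulVec]

lemma GR_pos (hm : 2 ≤ m) (A : ℕ → Mt n) (i : ℕ) (hi : i ≤ m) (hA : i = m → IsUnit (A m))
    (u p q : Sq n) :
    GR m (.pos i) (fiedlerX m A (.pos i)) u p q ↔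
      (q i = p i + (A i).mulVec (u i) ∧ (i = 0 → q i = 0) ∧ (i = m → p i = 0)) := by
  simp only [GR, fiedlerX]
  by_cases h0 : i = 0
  · have : ¬ i = m := by omega
    simp only [h0, if_true, show ¬ (0 = m) by omega, if_false, Matrix.neg_mulVec]
    constructor
    · rintro ⟨h1, h2⟩; simp [h1, h2]
    · rintro ⟨h1, h2, -⟩
      have h2 := h2 trivial
      rw [h2] at h1
      exact ⟨eq_neg_of_add_eq_zero_left h1.symm, h2⟩
  · by_cases h1 : i = m
    · subst h1
      simp only [h0, if_false, if_true, mulVec_inv_iff (hA rfl)]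
      constructor
      · rintro ⟨h1, h2⟩; simp [h1, h2]
      · rintro ⟨h1, -, h2⟩
        have h2 := h2 trivial
        rw [h2, zero_add] at h1
        exact ⟨h1, h2⟩
    · simp only [h0, h1, if_false, Matrix.neg_mulVec, false_imp_iff, and_true]
      constructor
      · intro h; rw [h]; abel
      · intro h; rw [h]; abel

lemma GR_neg (hm : 2 ≤ m) (A : ℕ → Mt n) (i : ℕ) (hi : i ≤ m) (hA : i = 0 → IsUnit (A 0))
    (u p q : Sq n) :
    GR m (.neg i) (fiedlerX m A (.neg i)) u p q ↔
      (q i = p i + (A i).mulVec (u i) ∧ (i = 0 → q i = 0) ∧ (i = m → p i = 0)) := by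
  simp only [GR, fiedlerX]
  by_cases h0 : i = 0
  · subst h0
    have hm0 : ¬ 0 = m := by omega
    simp only [if_true, mulVec_inv_iff ((IsUnit.neg (hA rfl)) : IsUnit (-A 0)), Matrix.neg_mulVec]
    constructor
    · rintro ⟨h1, h2⟩; simp [h1, h2, hm0]
    · rintro ⟨h1, h2, -⟩
      have h2 := h2 trivial
      rw [h2] at h1
      exact ⟨eq_neg_of_add_eq_zero_left h1.symm, h2⟩
  · by_cases h1 : i = m
    · subst h1
      simp only [h0, if_false, if_true]
      constructor
      · rintro ⟨h1, h2⟩; simp [h1, h2]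
      · rintro ⟨h1, -, h2⟩
        have h2 := h2 trivial
        rw [h2, zero_add] at h1
        exact ⟨h1, h2⟩
    · simp only [h0, h1, if_false, false_imp_iff, and_true]

/-- The core pencil. -/
noncomputable def Tm (m : ℕ) (A : ℕ → Mt n) (sig tau : List SIdx) (μ : ℂ) :
    Matrix (Fin m × Fin n) (Fin m × Fin n) ℂ :=
  μ • prodFiedler m n A tau - prodFiedler m n A sig

lemma Tm_iff {sig tau : List SIdx} (A : ℕ → Mt n) (μ : ℂ)
    (x : Fin m × Fin n → ℂ) : (Tm m A sig tau μ).mulVec x = 0 ↔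
    ∀ w < m, W ((bigProd m (fz m A sig)).mulVec x) w =
      μ • W ((bigProd m (fz m A tau)).mulVec x) w := by
  rw [Tm, Matrix.sub_mulVec, Matrix.smul_mulVec, prodFiedler_eq, prodFiedler_eq, sub_eq_zero]
  constructor
  · intro h w hw
    rw [← W_smul, h]
  · intro h
    apply W_ext
    intro w hw
    rw [h w hw, W_smul]

lemma ker_sol {sig tau sig2 tau2 : List SIdx} (H : RH m sig tau sig2 tau2) (A : ℕ → Mt n) (μ : ℂ)
    (hA0 : SIdx.neg 0 ∈ tau → IsUnit (A 0)) (hAm : SIdx.pos m ∈ sig → IsUnit (A m))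
    (κ : ℕ → Kd) (hκ : ∀ w < m, HasKind sig tau w (κ w))
    (x : Fin m × Fin n → ℂ) (hx : (Tm m A sig tau μ).mulVec x = 0) :
    ∃ u p q : Sq n, Sol m A μ (fun i => (κ i).isS) u p q ∧
      ∀ w < m, W x w = (κ w).sel u p q w := by
  rw [Tm_iff] at hx
  have m1 : ∀ t : List SIdx, (fz m A t).map Prod.fst = t := by
    intro t; simp [fz, Function.comp_def]
  have m2 : ∀ t : List SIdx, (fz m A t).map (fun a => a.1.val) = t.map SIdx.val := by
    intro t; simp [fz, Function.comp_def]
  obtain ⟨u1, p1, q1, -, g1, l1⟩ := claimB H.hm x (fz m A sig) (by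
    intro a ha
    obtain ⟨k, hk, rfl⟩ := List.mem_map.1 ha
    obtain ⟨i, rfl, hi⟩ := H.hpos k hk
    exact hi) (by rw [m2]; exact H.nds) 0 0 0
  obtain ⟨u, p, q, hag, g2, l2⟩ := claimB H.hm x (fz m A tau) (by
    intro a ha
    obtain ⟨k, hk, rfl⟩ := List.mem_map.1 ha
    obtain ⟨i, rfl, hi⟩ := H.hneg k hk
    exact hi) (by rw [m2]; exact H.ndt) u1 p1 q1
  have hag' : ∀ k ∈ sig, u k.val = u1 k.val ∧ p k.val = p1 k.val ∧ q k.val = q1 k.val := by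
    intro k hk
    apply hag
    rw [m2]
    intro h
    obtain ⟨k', hk', e⟩ := List.mem_map.1 h
    obtain ⟨i, rfl, hi⟩ := H.hpos k hk
    obtain ⟨j, rfl, hj⟩ := H.hneg k' hk'
    simp only [SIdx.val] at e
    subst e
    exact H.disj _ hk hk'
  have hgate : ∀ i ≤ m, (q i = p i + (A i).mulVec (u i) ∧ (i = 0 → q i = 0) ∧
      (i = m → p i = 0)) := by
    intro i hi
    rcases H.cover i hi with h | h
    · rw [← GR_pos H.hm A i hi (by rintro rfl; exact hAm h)]
      obtain ⟨a, b, c⟩ := hag' _ h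
      rw [GR_congr a b c]
      exact g1 (_, _) (List.mem_map.2 ⟨_, h, rfl⟩)
    · rw [← GR_neg H.hm A i hi (by rintro rfl; exact hA0 h)]
      exact g2 (_, _) (List.mem_map.2 ⟨_, h, rfl⟩)
  have hlk := fun w (hw : w < m) => (link_kind (hκ w hw) μ u p q (W x w)).1
    ⟨W ((bigProd m (fz m A tau)).mulVec x) w, by have := l2 w hw; rwa [m1] at this, by
      rw [← hx w hw, Link_congr sig hag']; have := l1 w hw; rwa [m1] at this⟩
  refine ⟨u, p, q, ⟨(hgate 0 (by omega)).2.1 rfl, (hgate m le_rfl).2.2 rfl,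
    fun i hi => (hgate i hi).1, ?_, ?_⟩, fun w hw => (hlk w hw).2⟩
  · intro i hi hS
    have := (hlk i hi).1
    rwa [if_pos hS] at this
  · intro i hi hS
    have := (hlk i hi).1
    rwa [if_neg (by simpa using hS)] at this

lemma sol_ker {sig tau sig2 tau2 : List SIdx} (H : RH m sig tau sig2 tau2) (A : ℕ → Mt n) (μ : ℂ)
    (hA0 : SIdx.neg 0 ∈ tau → IsUnit (A 0)) (hAm : SIdx.pos m ∈ sig → IsUnit (A m))
    (κ : ℕ → Kd) (hκ : ∀ w < m, HasKind sig tau w (κ w))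
    (x : Fin m × Fin n → ℂ) (u p q : Sq n)
    (hS : Sol m A μ (fun i => (κ i).isS) u p q)
    (hx : ∀ w < m, W x w = (κ w).sel u p q w) : (Tm m A sig tau μ).mulVec x = 0 := by
  have m1 : ∀ t : List SIdx, (fz m A t).map Prod.fst = t := by
    intro t; simp [fz, Function.comp_def]
  have hlk : ∀ w < m, ∃ y, Link u p q tau w (W x w) y ∧ Link u p q sig w (W x w) (μ • y) := by
    intro w hw
    rw [link_kind (hκ w hw)]
    refine ⟨?_, hx w hw⟩
    split_ifs with h
    · exact hS.linkS w hw h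
    · exact hS.linkM w hw (by simpa using h)
  choose! y hy1 hy2 using hlk
  have hgate : ∀ i ≤ m, (q i = p i + (A i).mulVec (u i) ∧ (i = 0 → q i = 0) ∧
      (i = m → p i = 0)) := fun i hi =>
    ⟨hS.gate i hi, by rintro rfl; exact hS.q0, by rintro rfl; exact hS.pm⟩
  rw [Tm_iff]
  intro w hw
  rw [claimA H.hm u p q x (fz m A tau) _ y (by rw [m1]; exact hy1) w hw]
  · refine claimA H.hm u p q x (fz m A sig) ?_ (fun w => μ • y w) (by rw [m1]; exact hy2) w hw
    intro a ha
    obtain ⟨k, hk, rfl⟩ := List.mem_map.1 ha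
    obtain ⟨i, rfl, hi⟩ := H.hpos k hk
    refine ⟨hi, ?_⟩
    simp only
    rw [GR_pos H.hm A i hi (by rintro rfl; exact hAm hk)]
    exact hgate i hi
  · intro a ha
    obtain ⟨k, hk, rfl⟩ := List.mem_map.1 ha
    obtain ⟨i, rfl, hi⟩ := H.hneg k hk
    refine ⟨hi, ?_⟩
    simp only
    rw [GR_neg H.hm A i hi (by rintro rfl; exact hA0 hk)]
    exact hgate i hi

end EG
namespace EG

variable {m n : ℕ}

/-- length of the greedy chain `t, t+1, …` in a list -/
def gr : SIdx → List SIdx → ℕ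
  | _, [] => 0
  | t, k :: l => if k = t then gr t.succ l + 1 else gr t l

lemma chain_iff (l : List SIdx) (t : SIdx) (p : ℕ) :
    (chainUp t p).Sublist l ↔ p + 1 ≤ gr t l := by
  induction l generalizing t p with
  | nil => cases p <;> simp [chainUp, gr]
  | cons k l ih =>
    by_cases h : k = t
    · subst h
      cases p with
      | zero => simp [chainUp, gr]
      | succ p =>
        simp only [chainUp, gr, if_true, List.cons_sublist_cons]
        rw [ih]; omega
    · have e : (chainUp t p).Sublist (k :: l) ↔ (chainUp t p).Sublist l := by
        constructor
        · intro hs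
          cases p with
          | zero =>
            simp only [chainUp] at hs ⊢
            rw [List.singleton_sublist] at hs ⊢
            rcases List.mem_cons.1 hs with h' | h'
            · exact absurd h'.symm h
            · exact h'
          | succ p =>
            simp only [chainUp] at hs ⊢
            cases hs with
            | cons _ h' => exact h'
            | cons_cons _ h' => exact absurd rfl h
        · intro hs; exact hs.cons _
      rw [e, ih]
      simp [gr, h]

lemma gr_le_length (t : SIdx) (l : List SIdx) : gr t l ≤ l.length := by
  induction l generalizing t with
  | nil => simp [gr]
  | cons k l ih =>
    simp only [gr, List.length_cons]
    split_ifs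
    · have := ih t.succ; omega
    · have := ih t; omega

lemma gr_pos_iff (t : SIdx) (l : List SIdx) : 0 < gr t l ↔ t ∈ l := by
  have := chain_iff l t 0
  simp only [chainUp, List.singleton_sublist] at this
  rw [this]; omega

lemma findGreatest_le_sub (g N : ℕ) (P : ℕ → Prop) [DecidablePred P] (hP : ∀ p, P p ↔ p + 1 ≤ g)
    (hN : g ≤ N) (hg : 0 < g) : Nat.findGreatest P N = g - 1 := by
  rw [Nat.findGreatest_eq_iff]
  refine ⟨by omega, fun _ => (hP _).2 (by omega), ?_⟩
  intro k hk _ hPk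
  have := (hP k).1 hPk
  omega

lemma consAt_eq (l : List SIdx) (t : SIdx) : consAt l t = (gr t l : ℤ) - 1 := by
  unfold consAt
  by_cases h : t ∈ l
  · simp only [h, if_true]
    have h' := (gr_pos_iff t l).2 h
    have h3 := @findGreatest_le_sub (gr t l) l.length (fun p => (chainUp t p).Sublist l)
      (Classical.decPred _) (chain_iff l t) (gr_le_length t l) h'
    have h4 : ((gr t l - 1 : ℕ) : ℤ) = (gr t l : ℤ) - 1 := by omega
    rw [← h4, ← h3]
  · simp only [h, if_false]
    have h' := (gr_pos_iff t l).not.2 h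
    omega

lemma invsAt_eq (l : List SIdx) (t : SIdx) : invsAt l t = consAt l.reverse t := by
  unfold invsAt consAt
  have e : ∀ p, ((chainUp t p).reverse).Sublist l ↔ (chainUp t p).Sublist l.reverse := by
    intro p
    rw [← List.reverse_sublist, List.reverse_reverse]
  simp only [e, List.mem_reverse, List.length_reverse]
  congr!

lemma gr_append (t : SIdx) (a b : List SIdx) :
    gr t (a ++ b) = gr t a + gr (SIdx.succ^[gr t a] t) b := by
  induction a generalizing t with
  | nil => simp [gr]
  | cons k a ih =>
    simp only [List.cons_append, gr]
    split_ifs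
    · rw [ih, Function.iterate_succ_apply]; omega
    · rw [ih]

lemma succ_iter_pos (i j : ℕ) : SIdx.succ^[j] (.pos i) = .pos (i + j) := by
  induction j with
  | zero => rfl
  | succ j ih => rw [Function.iterate_succ_apply', ih]; rfl

lemma gr_mem (s j : ℕ) (l : List SIdx) (h : j < gr (.pos s) l) : SIdx.pos (s + j) ∈ l := by
  induction l generalizing s j with
  | nil => simp [gr] at h
  | cons k l ih =>
    simp only [gr] at h
    split_ifs at h with hk
    · cases j with
      | zero => simp [hk]
      | succ j =>
        have := ih (s+1) j (by simpa [SIdx.succ] using h)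
        rw [show s + 1 + j = s + (j+1) by omega] at this
        exact List.mem_cons_of_mem _ this
    · exact List.mem_cons_of_mem _ (ih s j h)

lemma gr_pair (s j : ℕ) (l : List SIdx) (h : j + 1 < gr (.pos s) l) :
    [SIdx.pos (s + j), SIdx.pos (s + j + 1)].Sublist l := by
  induction l generalizing s j with
  | nil => simp [gr] at h
  | cons k l ih =>
    simp only [gr] at h
    split_ifs at h with hk
    · cases j with
      | zero =>
        subst hk
        simp only [add_zero, List.cons_sublist_cons, List.singleton_sublist]
        exact gr_mem (s+1) 0 l (by simpa [SIdx.succ] using h)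
      | succ j =>
        have := ih (s+1) j (by simpa [SIdx.succ] using h)
        rw [show s + 1 + j = s + (j+1) by omega] at this
        exact this.cons _
    · exact (ih s j h).cons _

lemma gr_max (s c : ℕ) (l : List SIdx) (hl : l.Nodup) (h : gr (.pos s) l = c + 1) :
    ¬ [SIdx.pos (s + c), SIdx.pos (s + c + 1)].Sublist l := by
  induction l generalizing s c with
  | nil => simp [gr] at h
  | cons k l ih =>
    rw [List.nodup_cons] at hl
    simp only [gr] at h
    split_ifs at h with hk
    · subst hk
      cases c with
      | zero =>
        simp only [add_zero, List.cons_sublist_cons, List.singleton_sublist]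
        intro hm
        have := (gr_pos_iff _ _).2 hm
        simp only [SIdx.succ] at h
        omega
      | succ c =>
        intro hs
        have := ih (s+1) c hl.2 (by simpa [SIdx.succ] using h)
        apply this
        rw [show s + 1 + c = s + (c+1) by omega]
        cases hs with
        | cons _ h' => exact h'
    · intro hs
      have hn := ih s c hl.2 h
      cases hs with
      | cons _ h' => exact hn h'
      | cons_cons _ h' =>
        exact hl.1 (gr_mem s c l (by omega))

section
variable {sig tau : List SIdx} {w : ℕ} {κ : Kd}

lemma kind_mem_pos (h : HasKind sig tau w κ) (i : ℕ) (hi : i = w ∨ i = w + 1) :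
    SIdx.pos i ∈ sig ↔ SIdx.pos i ∈ (κ.lists w).1 := by
  rw [← h, List.mem_filter]
  exact ⟨fun h => ⟨h, decide_eq_true hi⟩, fun h => h.1⟩

lemma kind_mem_neg (h : HasKind sig tau w κ) (i : ℕ) (hi : i = w ∨ i = w + 1) :
    SIdx.neg i ∈ tau ↔ SIdx.neg i ∈ (κ.lists w).2 := by
  rw [← h, List.mem_filter]
  exact ⟨fun h => ⟨h, decide_eq_true hi⟩, fun h => h.1⟩

lemma kind_k1 (h : HasKind sig tau w κ)
    (hs : [SIdx.pos w, SIdx.pos (w+1)].Sublist sig) : κ = .k1 := by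
  have h1 := hs.filter (fun k => decide (touch k w))
  have h2 : sig.filter (fun k => decide (touch k w)) = (κ.lists w).1 := by rw [← h]
  rw [h2] at h1
  simp only [touch, SIdx.val, List.filter_cons, List.filter_nil, true_or, or_true, decide_true,
    if_true] at h1
  cases κ <;> simp only [Kd.lists] at h1
  · rfl
  all_goals
    have := h1.length_le
    simp at this
  have := h1.eq_of_length rfl
  simp at this

lemma kind_k5 (h : HasKind sig tau w κ)
    (hs : [SIdx.neg (w+1), SIdx.neg w].Sublist tau) : κ = .k5 := by
  have h1 := hs.filter (fun k => decide (touch k w))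
  have h2 : tau.filter (fun k => decide (touch k w)) = (κ.lists w).2 := by rw [← h]
  rw [h2] at h1
  simp only [touch, SIdx.val, List.filter_cons, List.filter_nil, true_or, or_true, decide_true,
    if_true] at h1
  cases κ <;> simp only [Kd.lists] at h1
  case k5 => rfl
  all_goals
    have := h1.length_le
    simp at this
  have := h1.eq_of_length rfl
  simp at this

lemma kind_sig_last (h : HasKind sig tau w κ) (hs : SIdx.pos w ∈ sig)
    (hn : ¬ [SIdx.pos w, SIdx.pos (w+1)].Sublist sig) : κ = .k2 ∨ κ = .k3 := by
  rw [kind_mem_pos h w (by simp)] at hs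
  have h2 : (κ.lists w).1.Sublist sig := by rw [← h]; exact List.filter_sublist
  cases κ <;> simp [Kd.lists] at hs h2 ⊢
  exact hn h2

lemma kind_k4 (h : HasKind sig tau w κ) (hs : SIdx.neg w ∈ tau) (hn : SIdx.pos (w+1) ∈ sig) :
    κ = .k4 := by
  rw [kind_mem_neg h w (by simp)] at hs
  rw [kind_mem_pos h (w+1) (by simp)] at hn
  cases κ <;> simp [Kd.lists] at hs hn ⊢

lemma kind_k6 (h : HasKind sig tau w κ) (hs : SIdx.neg w ∈ tau) (hs' : SIdx.neg (w+1) ∈ tau)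
    (hn : ¬ [SIdx.neg (w+1), SIdx.neg w].Sublist tau) : κ = .k6 := by
  rw [kind_mem_neg h w (by simp)] at hs
  rw [kind_mem_neg h (w+1) (by simp)] at hs'
  have h2 : (κ.lists w).2.Sublist tau := by rw [← h]; exact List.filter_sublist
  cases κ <;> simp [Kd.lists] at hs hs' h2 ⊢
  exact hn h2

end

lemma SIPL.tail {a : SIdx} {l : List SIdx} (h : SIPL (a :: l)) : SIPL l := by
  intro l1 b l2 l3 e
  exact h (a :: l1) b l2 l3 (by rw [e]; rfl)

lemma SIPL.drop {a k : SIdx} {l : List SIdx} (h : SIPL (a :: k :: l)) (hk : k ≠ a.succ) :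
    SIPL (a :: l) := by
  intro l1 b l2 l3 e
  cases l1 with
  | nil =>
    simp only [List.nil_append, List.cons.injEq] at e
    obtain ⟨rfl, rfl⟩ := e
    have := h [] a (k :: l2) l3 rfl
    rcases List.mem_cons.1 this with h' | h'
    · exact absurd h'.symm hk
    · exact h'
  | cons c l1 =>
    simp only [List.cons_append, List.cons.injEq] at e
    exact h.tail.tail l1 b l2 l3 e.2

lemma SIPL.head {a : SIdx} {s l : List SIdx} (h : SIPL (s ++ l)) (ha : a ∈ s)
    (hn : ¬ [a, a.succ].Sublist s) : SIPL (a :: l) := by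
  obtain ⟨α, β, rfl⟩ := List.append_of_mem ha
  have hβ : a.succ ∉ β := by
    intro hb
    apply hn
    refine List.Sublist.trans ?_ (List.sublist_append_right α (a :: β))
    rw [List.cons_sublist_cons, List.singleton_sublist]
    exact hb
  intro l1 b l2 l3 e
  cases l1 with
  | nil =>
    simp only [List.nil_append, List.cons.injEq] at e
    obtain ⟨rfl, rfl⟩ := e
    have := h α a (β ++ l2) l3 (by simp)
    rcases List.mem_append.1 this with h' | h'
    · exact absurd h' hβ
    · exact h'
  | cons c l1 =>
    simp only [List.cons_append, List.cons.injEq] at e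
    exact h ((α ++ a :: β) ++ l1) b l2 l3 (by rw [e.2]; simp)

lemma act_pos_def (i : ℕ) (w : ℕ) (X : Mt n) (f : Sq n) :
    act m (.pos i) X f w = if i = 0 then (if w = 0 then X.mulVec (f 0) else f w)
      else if i = m then (if w + 1 = m then X.mulVec (f w) else f w)
      else if w = i then X.mulVec (f i) + f (i - 1) else if w + 1 = i then f i else f w := rfl

lemma act_neg_def (i : ℕ) (w : ℕ) (X : Mt n) (f : Sq n) :
    act m (.neg i) X f w = if i = 0 then (if w = 0 then X.mulVec (f 0) else f w)
      else if i = m then (if w + 1 = m then X.mulVec (f w) else f w)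
      else if w = i then f (i - 1) else if w + 1 = i then f i + X.mulVec (f (i - 1)) else f w := rfl

lemma act_none {k : SIdx} {w : ℕ} (h : ¬ touch k w) (X : Mt n) (f : Sq n) :
    act m k X f w = f w := by
  rcases k with i | i <;> simp only [touch, SIdx.val, not_or] at h <;>
    simp only [act_pos_def, act_neg_def] <;> (
    by_cases h0 : i = 0
    · rw [if_pos h0, if_neg (by omega)]
    · rw [if_neg h0]
      by_cases h1 : i = m
      · rw [if_pos h1, if_neg (by omega)]
      · rw [if_neg h1, if_neg (by omega), if_neg (by omega)])

lemma track_none (hm : 2 ≤ m) (x : Fin m × Fin n → ℂ) (w : ℕ) (hw : w < m)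
    (z : List (SIdx × Mt n)) (hz : ∀ k ∈ z.map Prod.fst, k.val ≤ m ∧ ¬ touch k w) :
    W ((bigProd m z).mulVec x) w = W x w := by
  induction z with
  | nil => rw [bigProd_nil]
  | cons a z ih =>
    have h := hz a.1 (by simp)
    rw [bigProd_cons, W_elem hm _ h.1 _ _ _ hw, act_none h.2]
    exact ih (fun k hk => hz k (by rw [List.map_cons]; exact List.mem_cons_of_mem _ hk))

lemma track_pos (hm : 2 ≤ m) (x : Fin m × Fin n → ℂ) (z : List (SIdx × Mt n))
    (hz : ∀ k ∈ z.map Prod.fst, ∃ i, k = .pos i ∧ i + 2 ≤ m) (w : ℕ) (hw : w < m)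
    (hS : SIPL (.pos w :: z.map Prod.fst)) :
    w + gr (.pos (w+1)) (z.map Prod.fst) < m ∧
    W ((bigProd m z).mulVec x) w = W x (w + gr (.pos (w+1)) (z.map Prod.fst)) := by
  induction z generalizing w with
  | nil => simp [bigProd_nil, gr, hw]
  | cons a z ih =>
    obtain ⟨i, hi, him⟩ := hz a.1 (by simp)
    have hz' : ∀ k ∈ z.map Prod.fst, ∃ i, k = SIdx.pos i ∧ i + 2 ≤ m :=
      fun k hk => hz k (by rw [List.map_cons]; exact List.mem_cons_of_mem _ hk)
    simp only [List.map_cons, hi] at hS ⊢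
    rw [bigProd_cons, W_elem hm _ (by rw [hi]; simp only [SIdx.val]; omega) _ _ _ hw, hi]
    by_cases h1 : i = w + 1
    · subst h1
      have := ih hz' (w+1) (by omega) hS.tail
      simp only [gr, if_true, SIdx.succ]
      have e : w + (gr (.pos (w + 1 + 1)) (z.map Prod.fst) + 1) =
        w + 1 + gr (.pos (w + 1 + 1)) (z.map Prod.fst) := by omega
      rw [e, ← this.2]
      refine ⟨this.1, ?_⟩
      rw [act_pos_def, if_neg (by omega), if_neg (by omega), if_neg (by omega), if_pos rfl]
    · by_cases h2 : i = w
      · subst h2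
        exact absurd (hS [] (.pos i) [] _ rfl) (by simp)
      · have := ih hz' w hw (hS.drop (by simp [SIdx.succ, h1]))
        have e : gr (.pos (w+1)) (SIdx.pos i :: z.map Prod.fst) =
          gr (.pos (w+1)) (z.map Prod.fst) := by simp [gr, h1]
        rw [e, act_none (by simp [touch, SIdx.val, h1, h2])]
        exact this

lemma track_neg (hm : 2 ≤ m) (x : Fin m × Fin n → ℂ) (z : List (SIdx × Mt n))
    (hz : ∀ k ∈ z.map Prod.fst, ∃ i, k = .neg i ∧ 2 ≤ i ∧ i ≤ m) (w : ℕ) (hw : w < m)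
    (hS : SIPL (.neg (w+1) :: z.map Prod.fst)) :
    gr (.neg w) (z.map Prod.fst) ≤ w ∧
    W ((bigProd m z).mulVec x) w = W x (w - gr (.neg w) (z.map Prod.fst)) := by
  induction z generalizing w with
  | nil => simp [bigProd_nil, gr]
  | cons a z ih =>
    obtain ⟨i, hi, hi2, him⟩ := hz a.1 (by simp)
    have hz' : ∀ k ∈ z.map Prod.fst, ∃ i, k = SIdx.neg i ∧ 2 ≤ i ∧ i ≤ m :=
      fun k hk => hz k (by rw [List.map_cons]; exact List.mem_cons_of_mem _ hk)
    simp only [List.map_cons, hi] at hS ⊢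
    rw [bigProd_cons, W_elem hm _ (by rw [hi]; simp only [SIdx.val]; omega) _ _ _ hw, hi]
    by_cases h1 : i = w
    · subst h1
      obtain ⟨v, rfl⟩ : ∃ v, i = v + 1 := ⟨i - 1, by omega⟩
      have := ih hz' v (by omega) hS.tail
      simp only [gr, if_true, SIdx.succ]
      have e : v + 1 - (gr (.neg v) (z.map Prod.fst) + 1) =
        v - gr (.neg v) (z.map Prod.fst) := by omega
      rw [e, ← this.2]
      refine ⟨by omega, ?_⟩
      rw [act_neg_def, if_neg (by omega), if_neg (by omega), if_pos rfl, Nat.add_sub_cancel]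
    · by_cases h2 : i = w + 1
      · subst h2
        exact absurd (hS [] (.neg (w+1)) [] _ rfl) (by simp)
      · have := ih hz' w hw (hS.drop (by simp [SIdx.succ, h1]))
        have e : gr (.neg w) (SIdx.neg i :: z.map Prod.fst) =
          gr (.neg w) (z.map Prod.fst) := by simp [gr, h1]
        rw [e, act_none (by simp [touch, SIdx.val, h1, h2])]
        exact this

end EG
namespace EG

variable {m n : ℕ}

/-- everything known about a vector in the kernel -/
structure Ctx (m : ℕ) (sig tau sig2 tau2 : List SIdx) (A : ℕ → Mt n) (μ : ℂ) (κ : ℕ → Kd)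
    (u p q : Sq n) (z2 w2 : List (SIdx × Mt n)) (x : Fin m × Fin n → ℂ) : Prop where
  H : RH m sig tau sig2 tau2
  hκ : ∀ w < m, HasKind sig tau w (κ w)
  hS : Sol m A μ (fun i => (κ i).isS) u p q
  hz : z2.map Prod.fst = sig2
  hw : w2.map Prod.fst = tau2
  hx : ∀ w < m, W ((bigProd m z2).mulVec ((bigProd m w2).mulVec x)) w = (κ w).sel u p q w

section
variable {sig tau sig2 tau2 : List SIdx} {A : ℕ → Mt n} {μ : ℂ} {κ : ℕ → Kd}
    {u p q : Sq n} {z2 w2 : List (SIdx × Mt n)} {x : Fin m × Fin n → ℂ}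

lemma RH.pos_le (H : RH m sig tau sig2 tau2) {i : ℕ} (h : SIdx.pos i ∈ sig) : i ≤ m := by
  obtain ⟨j, hj, hjm⟩ := H.hpos _ h
  cases hj
  exact hjm

lemma RH.neg_le (H : RH m sig tau sig2 tau2) {i : ℕ} (h : SIdx.neg i ∈ tau) : i ≤ m := by
  obtain ⟨j, hj, hjm⟩ := H.hneg _ h
  cases hj
  exact hjm

lemma RH.sig2_form (H : RH m sig tau sig2 tau2) :
    ∀ k ∈ sig2, ∃ i, k = SIdx.pos i ∧ i + 2 ≤ m := by
  intro k hk
  obtain ⟨h1, h2⟩ := H.hs2 k hk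
  obtain ⟨i, rfl, _⟩ := H.hpos k h1
  exact ⟨i, rfl, h2⟩

lemma RH.tau2_form (H : RH m sig tau sig2 tau2) :
    ∀ k ∈ tau2, ∃ i, k = SIdx.neg i ∧ 2 ≤ i ∧ i ≤ m := by
  intro k hk
  obtain ⟨h1, h2⟩ := H.ht2 k hk
  obtain ⟨i, rfl, h3⟩ := H.hneg k h1
  exact ⟨i, rfl, h2, h3⟩

lemma Ctx.sig_u (C : Ctx m sig tau sig2 tau2 A μ κ u p q z2 w2 x) (s c : ℕ)
    (hg : gr (.pos s) sig = c + 1) : ∀ j ≤ c, u (s + j) = u s := by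
  intro j
  induction j with
  | zero => intro _; rfl
  | succ j ih =>
    intro hj
    have hp := gr_pair s j sig (by omega)
    have hle : s + j + 1 ≤ m := C.H.pos_le (hp.subset (by simp))
    have hk := kind_k1 (C.hκ (s+j) (by omega)) hp
    have := (C.hS.linkS (s+j) (by omega) (by simp [hk, Kd.isS])).1
    rw [← ih (by omega), ← this]
    rfl

lemma neg_pair (a b : ℕ) : [SIdx.pos a, SIdx.pos b].Sublist (tau.map SIdx.negate).reverse ↔
    [SIdx.neg b, SIdx.neg a].Sublist tau := by
  have e : SIdx.negate ∘ SIdx.negate = id := by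
    funext k; cases k <;> rfl
  rw [← List.reverse_sublist, List.reverse_reverse]
  constructor
  · intro h
    have := h.map SIdx.negate
    rw [List.map_map, e, List.map_id] at this
    exact this
  · intro h
    exact h.map SIdx.negate

lemma neg_mem (a : ℕ) : SIdx.pos a ∈ (tau.map SIdx.negate).reverse ↔ SIdx.neg a ∈ tau := by
  rw [List.mem_reverse, List.mem_map]
  constructor
  · rintro ⟨k, hk, e⟩
    cases k <;> simp [SIdx.negate] at e
    rwa [← e]
  · intro h; exact ⟨_, h, rfl⟩

lemma Ctx.tau_u (C : Ctx m sig tau sig2 tau2 A μ κ u p q z2 w2 x) (c : ℕ)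
    (hg : gr (.pos 0) (tau.map SIdx.negate).reverse = c + 1) : ∀ j ≤ c, u j = u 0 := by
  intro j
  induction j with
  | zero => intro _; rfl
  | succ j ih =>
    intro hj
    have hp := gr_pair 0 j _ (by rw [hg]; omega)
    rw [neg_pair, zero_add] at hp
    have hle : j + 1 ≤ m := C.H.neg_le (hp.subset (by simp))
    have hk := kind_k5 (C.hκ j (by omega)) hp
    have := (C.hS.linkS j (by omega) (by simp [hk, Kd.isS])).1
    rw [← ih (by omega), ← this]

lemma RH.no_negsucc (H : RH m sig tau sig2 tau2) {v : ℕ} (h : SIdx.neg v ∉ tau) :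
    SIdx.neg (v+1) ∉ tau2 := by
  intro h2
  have h1 := (H.ht2 _ h2).1
  obtain ⟨a, b, e⟩ := List.append_of_mem h1
  obtain ⟨a', b', e'⟩ := List.append_of_mem h2
  have := H.sipt a (.neg (v+1)) (b ++ a') b' (by rw [e, e']; simp)
  simp only [SIdx.succ] at this
  rcases List.mem_append.1 this with h' | h'
  · exact h (by rw [e]; simp [h'])
  · exact h (H.ht2 _ (by rw [e']; simp [h'])).1

lemma Ctx.tau2_none (C : Ctx m sig tau sig2 tau2 A μ κ u p q z2 w2 x) {v : ℕ} (hv : v < m)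
    (h : SIdx.neg v ∉ tau) : W ((bigProd m w2).mulVec x) v = W x v := by
  apply track_none C.H.hm _ _ hv
  rw [C.hw]
  intro k hk
  obtain ⟨i, rfl, hi2, him⟩ := C.H.tau2_form k hk
  refine ⟨him, ?_⟩
  simp only [touch, SIdx.val]
  rintro (rfl | rfl)
  · exact h (C.H.ht2 _ hk).1
  · exact C.H.no_negsucc h hk

lemma Ctx.sig2_none (C : Ctx m sig tau sig2 tau2 A μ κ u p q z2 w2 x) {v : ℕ} (hv : v < m)
    (h : SIdx.pos v ∉ sig2) (h' : SIdx.pos (v+1) ∉ sig2) :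
    W ((bigProd m z2).mulVec ((bigProd m w2).mulVec x)) v = W ((bigProd m w2).mulVec x) v := by
  apply track_none C.H.hm _ _ hv
  rw [C.hz]
  intro k hk
  obtain ⟨i, rfl, hi⟩ := C.H.sig2_form k hk
  refine ⟨by simp only [SIdx.val]; omega, ?_⟩
  simp only [touch, SIdx.val]
  rintro (rfl | rfl)
  · exact h hk
  · exact h' hk

lemma Ctx.pos_rec (C : Ctx m sig tau sig2 tau2 A μ κ u p q z2 w2 x) (s c : ℕ)
    (hg : gr (.pos s) sig = c + 1) (hc : s + c < m) :
    ∃ w < m, s + gr (.pos s) (sig ++ sig2) = w + 1 ∧ W x w = u s := by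
  have hmem : SIdx.pos (s + c) ∈ sig := gr_mem s c sig (by omega)
  have hmax := gr_max s c sig C.H.nds.of_map hg
  have hk := kind_sig_last (C.hκ (s+c) hc) hmem hmax
  have hxx := C.hx (s+c) hc
  have hsel : (κ (s+c)).sel u p q (s+c) = u s := by
    rw [← C.sig_u s c hg c le_rfl]
    rcases hk with hk | hk <;> rw [hk] <;> rfl
  rw [hsel] at hxx
  have hT := track_pos C.H.hm ((bigProd m w2).mulVec x) z2 (by rw [C.hz]; exact C.H.sig2_form)
    (s+c) hc (by rw [C.hz]; exact C.H.sips.head hmem hmax)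
  rw [hxx, C.hz] at hT
  have hga : gr (.pos s) (sig ++ sig2) = c + 1 + gr (.pos (s+c+1)) sig2 := by
    rw [gr_append, hg, succ_iter_pos]; rfl
  refine ⟨s + c + gr (.pos (s+c+1)) sig2, hT.1, by rw [hga]; omega, ?_⟩
  rw [hT.2]
  refine (C.tau2_none hT.1 ?_).symm
  have h1 : SIdx.pos (s + (c + gr (.pos (s+c+1)) sig2)) ∈ sig ++ sig2 :=
    gr_mem s _ _ (by rw [hga]; omega)
  rw [← add_assoc] at h1
  apply C.H.disj
  rcases List.mem_append.1 h1 with h | h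
  · exact h
  · exact (C.H.hs2 _ h).1

lemma SIPL.cons_of_notMem {a : SIdx} {l : List SIdx} (h : SIPL l) (ha : a ∉ l) :
    SIPL (a :: l) := by
  intro l1 b l2 l3 e
  cases l1 with
  | nil =>
    simp only [List.nil_append, List.cons.injEq] at e
    obtain ⟨rfl, rfl⟩ := e
    exact absurd (by simp) ha
  | cons c l1 =>
    simp only [List.cons_append, List.cons.injEq] at e
    exact h l1 b l2 l3 e.2

lemma SIPL.suffix {s l : List SIdx} (h : SIPL (s ++ l)) : SIPL l := by
  intro l1 b l2 l3 e
  exact h (s ++ l1) b l2 l3 (by rw [e]; simp)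

/-- the recovery matrix -/
noncomputable def Fmat (m n : ℕ) (A : ℕ → Matrix (Fin n) (Fin n) ℂ) (sig tau sig2 tau2 : List SIdx) :
    Matrix (Fin n) (Fin m × Fin n) ℂ :=
  let ω := tau.map SIdx.negate
  let i0 := invsAt ω (.pos 0)
  if SIdx.pos 0 ∈ sig then
    (if consAt sig (.pos 0) < (m : ℤ) then
      rowSel m n ((m : ℤ) - consAt (sig ++ sig2) (.pos 0))
    else (A m)⁻¹ * rowSel m n 1)
  else if SIdx.pos (i0.toNat + 1) ∈ sig then
    (if i0 + consAt sig (.pos (i0.toNat + 1)) + 1 < (m : ℤ) then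
      rowSel m n ((m : ℤ) - (i0 + consAt (sig ++ sig2) (.pos (i0.toNat + 1)) + 1))
    else (A m)⁻¹ * rowSel m n (consAt tau2 (.neg (m - 1)) + 2))
  else if i0 < (m : ℤ) then
    rowSel m n ((m : ℤ) - (i0 - consAt tau2 (.neg i0.toNat) - 1))
  else (A 0)⁻¹ * rowSel m n (m : ℤ)

lemma inv_mulVec_cancel {B : Mt n} (h : IsUnit B) (v : Fin n → ℂ) :
    B⁻¹.mulVec (B.mulVec v) = v := by
  rw [Matrix.mulVec_mulVec, Matrix.nonsing_inv_mul _ ((Matrix.isUnit_iff_isUnit_det _).1 h),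
    Matrix.one_mulVec]

lemma Ctx.qm (C : Ctx m sig tau sig2 tau2 A μ κ u p q z2 w2 x) : q m = (A m).mulVec (u m) := by
  rw [C.hS.gate m le_rfl, C.hS.pm, zero_add]

lemma recover_sig (C : Ctx m sig tau sig2 tau2 A μ κ u p q z2 w2 x)
    (hAm : SIdx.pos m ∈ sig → IsUnit (A m)) (h0 : SIdx.pos 0 ∈ sig) :
    (Fmat m n A sig tau sig2 tau2).mulVec x = u 0 := by
  obtain ⟨c, hc⟩ : ∃ c, gr (.pos 0) sig = c + 1 :=
    ⟨gr (.pos 0) sig - 1, by have := (gr_pos_iff (.pos 0) sig).2 h0; omega⟩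
  have hm := C.H.hm
  simp only [Fmat, h0, if_true, consAt_eq, hc]
  by_cases hcm : c < m
  · rw [if_pos (by push_cast; omega)]
    obtain ⟨w, hw, e, hu⟩ := C.pos_rec 0 c hc (by omega)
    rw [rowSel_mulVec x w hw _ (by omega), hu]
  · have hmem : SIdx.pos (0 + c) ∈ sig := gr_mem 0 c sig (by omega)
    rw [zero_add] at hmem
    have : c = m := by have := C.H.pos_le hmem; omega
    subst this
    rw [if_neg (by push_cast; omega), ← Matrix.mulVec_mulVec,
      rowSel_mulVec x (c-1) (by omega) _ (by omega)]
    have hp := gr_pair 0 (c-1) sig (by omega)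
    rw [zero_add] at hp
    have hk := kind_k1 (C.hκ (c-1) (by omega)) hp
    have hxx := C.hx (c-1) (by omega)
    have hu := C.sig_u 0 c hc c le_rfl
    rw [zero_add] at hu
    rw [hk, C.sig2_none (by omega) ?_ ?_, C.tau2_none (by omega)] at hxx
    · rw [hxx]
      simp only [Kd.sel]
      rw [show c - 1 + 1 = c by omega, C.qm, hu, inv_mulVec_cancel (hAm hmem)]
    · exact C.H.disj _ (hp.subset (by simp))
    · intro h; have := (C.H.hs2 _ h).2; simp only [SIdx.val] at this; omega
    · intro h; have := (C.H.hs2 _ h).2; simp only [SIdx.val] at this; omega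

lemma recover_tau (C : Ctx m sig tau sig2 tau2 A μ κ u p q z2 w2 x)
    (hA0 : SIdx.neg 0 ∈ tau → IsUnit (A 0))
    (hAm : SIdx.pos m ∈ sig → IsUnit (A m)) (h0 : SIdx.pos 0 ∉ sig) :
    (Fmat m n A sig tau sig2 tau2).mulVec x =
      (if invsAt (tau.map SIdx.negate) (.pos 0) < (m : ℤ) then μ else -1) • u 0 := by
  have hm := C.H.hm
  have h0t : SIdx.neg 0 ∈ tau := (C.H.cover 0 (by omega)).resolve_left h0
  obtain ⟨i, hi⟩ : ∃ i, gr (.pos 0) (tau.map SIdx.negate).reverse = i + 1 :=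
    ⟨gr (.pos 0) (tau.map SIdx.negate).reverse - 1, by
      have := (gr_pos_iff (.pos 0) _).2 ((neg_mem (tau := tau) 0).2 h0t); omega⟩
  have hti : SIdx.neg i ∈ tau := by
    rw [← neg_mem, ← zero_add i]
    exact gr_mem 0 i _ (by omega)
  have him := C.H.neg_le hti
  have hui := C.tau_u i hi
  have hndt : (tau.map SIdx.negate).reverse.Nodup := by
    rw [List.nodup_reverse]
    refine C.H.ndt.of_map.map ?_
    intro a b hab
    cases a <;> cases b <;> simp_all [SIdx.negate]
  have hmaxi := gr_max 0 i _ hndt hi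
  rw [neg_pair, zero_add] at hmaxi
  have hi0 : invsAt (tau.map SIdx.negate) (.pos 0) = (i : ℤ) := by
    rw [invsAt_eq, consAt_eq, hi]; push_cast; ring
  have hnp : ∀ j, SIdx.neg j ∈ tau → SIdx.pos j ∉ sig := fun j h h' => C.H.disj j h' h
  simp only [Fmat, h0, if_false, hi0, Int.toNat_natCast]
  by_cases h1 : SIdx.pos (i+1) ∈ sig
  · simp only [h1, if_true]
    have him1 := C.H.pos_le h1
    rw [if_pos (by omega : (i:ℤ) < m)]
    have hk := kind_k4 (C.hκ i (by omega)) hti h1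
    have hL := C.hS.linkM i (by omega) (by simp [hk, Kd.isS])
    have hu1 : u (i+1) = μ • u 0 := by rw [hL.1, hui i le_rfl]
    obtain ⟨c, hc⟩ : ∃ c, gr (.pos (i+1)) sig = c + 1 :=
      ⟨gr (.pos (i+1)) sig - 1, by have := (gr_pos_iff (.pos (i+1)) sig).2 h1; omega⟩
    simp only [consAt_eq, hc]
    by_cases hcm : i + 1 + c < m
    · rw [if_pos (by push_cast; omega)]
      obtain ⟨w, hw, e, hu⟩ := C.pos_rec (i+1) c hc (by omega)
      rw [rowSel_mulVec x w hw _ (by omega), hu, hu1]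
    · rw [if_neg (by push_cast; omega), ← Matrix.mulVec_mulVec]
      have hmem : SIdx.pos (i + 1 + c) ∈ sig := gr_mem (i+1) c sig (by omega)
      have hmm : m = i + 1 + c := by have := C.H.pos_le hmem; omega
      rw [← hmm] at hmem
      have hum := C.sig_u (i+1) c hc c le_rfl
      rw [← hmm, hu1] at hum
      have hsel : (κ (m-1)).sel u p q (m-1) = (A m).mulVec (μ • u 0) := by
        rw [← hum, ← C.qm]
        cases c with
        | zero =>
          rw [show m - 1 = i by omega, hk]
          simp only [Kd.sel]
          rw [hL.2, hmm]
        | succ c =>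
          have hp := gr_pair (i+1) c sig (by omega)
          rw [show i + 1 + c = m - 1 by omega] at hp
          have hk' := kind_k1 (C.hκ (m-1) (by omega)) hp
          rw [hk']
          simp only [Kd.sel]
          rw [show m - 1 + 1 = m by omega]
      have hxx := C.hx (m-1) (by omega)
      rw [hsel, C.sig2_none (by omega) ?_ ?_] at hxx
      · have hT := track_neg C.H.hm x w2 (by rw [C.hw]; exact C.H.tau2_form) (m-1) (by omega) (by
          rw [C.hw, show m - 1 + 1 = m by omega]
          refine C.H.sipt.suffix.cons_of_notMem ?_
          intro h
          exact C.H.disj m hmem (C.H.ht2 _ h).1)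
        rw [hxx, C.hw] at hT
        rw [rowSel_mulVec x (m - 1 - gr (.neg (m-1)) tau2) (by omega) _ (by omega), ← hT.2,
          inv_mulVec_cancel (hAm hmem)]
      · intro h; have := (C.H.hs2 _ h).2; simp only [SIdx.val] at this; omega
      · intro h; have := (C.H.hs2 _ h).2; simp only [SIdx.val] at this; omega
  · simp only [h1, if_false]
    by_cases hlt : i < m
    · rw [if_pos (by omega : (i:ℤ) < m), if_pos (by omega : (i:ℤ) < m)]
      have h1t : SIdx.neg (i+1) ∈ tau := (C.H.cover (i+1) (by omega)).resolve_left h1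
      have hk := kind_k6 (C.hκ i hlt) hti h1t hmaxi
      have hL := C.hS.linkM i (by omega) (by simp [hk, Kd.isS])
      have hxx := C.hx i hlt
      rw [hk, C.sig2_none hlt ?_ ?_] at hxx
      · simp only [Kd.sel] at hxx
        rw [hL.1, hui i le_rfl] at hxx
        have hT := track_neg C.H.hm x w2 (by rw [C.hw]; exact C.H.tau2_form) i hlt (by
          rw [C.hw]; exact C.H.sipt.head h1t hmaxi)
        rw [hxx, C.hw] at hT
        rw [consAt_eq, rowSel_mulVec x (i - gr (.neg i) tau2) (by omega) _ (by omega), ← hT.2]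
      · intro h; exact hnp _ hti (C.H.hs2 _ h).1
      · intro h; exact hnp _ h1t (C.H.hs2 _ h).1
    · have hie : i = m := by omega
      subst hie
      rw [if_neg (by omega), if_neg (by omega), ← Matrix.mulVec_mulVec,
        rowSel_mulVec x 0 (by omega) _ (by push_cast; ring)]
      have hp := gr_pair 0 0 _ (show 0 + 1 < gr (.pos 0) (tau.map SIdx.negate).reverse by omega)
      rw [neg_pair] at hp
      have hk := kind_k5 (C.hκ 0 (by omega)) hp
      have hxx := C.hx 0 (by omega)
      have h1t : SIdx.neg 1 ∈ tau := hp.subset (by simp)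
      rw [hk, C.sig2_none (by omega) ?_ ?_, track_none hm x 0 (by omega) w2 ?_] at hxx
      · rw [hxx]
        simp only [Kd.sel]
        have hg := C.hS.gate 0 (by omega)
        rw [C.hS.q0] at hg
        have hp0 : p 0 = (A 0).mulVec (-u 0) := by
          rw [Matrix.mulVec_neg]
          exact eq_neg_of_add_eq_zero_left hg.symm
        rw [hp0, inv_mulVec_cancel (hA0 h0t), neg_smul, one_smul]
      · rw [C.hw]
        intro k hk
        obtain ⟨j, rfl, h2, h3⟩ := C.H.tau2_form k hk
        refine ⟨h3, ?_⟩
        simp only [touch, SIdx.val]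
        omega
      · intro h; exact hnp _ h0t (C.H.hs2 _ h).1
      · intro h; exact hnp _ h1t (C.H.hs2 _ h).1

end

lemma Pol_zero (A : ℕ → Mt n) : Pol m A 0 = A 0 := by
  rw [Pol, Finset.sum_range_succ']
  simp

lemma recover {sig tau sig2 tau2 : List SIdx} (H : RH m sig tau sig2 tau2) (A : ℕ → Mt n) (μ : ℂ)
    (hA0 : SIdx.neg 0 ∈ tau → IsUnit (A 0)) (hAm : SIdx.pos m ∈ sig → IsUnit (A m))
    (hdet : (Pol m A μ).det = 0) : ∃ c : ℂ, c ≠ 0 ∧ ∀ κ u p q z2 w2 x,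
      Ctx m sig tau sig2 tau2 A μ κ u p q z2 w2 x →
      (Fmat m n A sig tau sig2 tau2).mulVec x = c • u 0 := by
  by_cases h0 : SIdx.pos 0 ∈ sig
  · refine ⟨1, one_ne_zero, ?_⟩
    intro κ u p q z2 w2 x C
    rw [recover_sig C hAm h0, one_smul]
  · refine ⟨_, ?_, fun κ u p q z2 w2 x C => recover_tau C hA0 hAm h0⟩
    split_ifs
    · rintro rfl
      rw [Pol_zero] at hdet
      have h0t : SIdx.neg 0 ∈ tau := (H.cover 0 (by omega)).resolve_left h0
      have := (Matrix.isUnit_iff_isUnit_det _).1 (hA0 h0t)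
      rw [hdet] at this
      simp at this
    · simp

end EG
namespace EG

variable {m n : ℕ}

lemma act_inj (hm : 2 ≤ m) (k : SIdx) (hk : k.val ≤ m) (X : Mt n)
    (hX : (k.val = 0 ∨ k.val = m) → IsUnit X) (f g : Sq n)
    (h : ∀ w < m, act m k X f w = act m k X g w) : ∀ w < m, f w = g w := by
  have hinj : IsUnit X → ∀ a b : Fin n → ℂ, X.mulVec a = X.mulVec b → a = b := by
    intro hU a b hab
    rw [← inv_mulVec_cancel hU a, hab, inv_mulVec_cancel hU]
  intro w hw
  have e0 : ∀ i, (i = 0 → IsUnit X) → i = 0 →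
      ((if w = 0 then X.mulVec (f 0) else f w) = (if w = 0 then X.mulVec (g 0) else g w)) →
      f w = g w := by
    intro i hU hi he
    by_cases h0 : w = 0
    · rw [if_pos h0, if_pos h0] at he
      rw [h0]
      exact hinj (hU hi) _ _ he
    · rwa [if_neg h0, if_neg h0] at he
  have e1 : IsUnit X →
      ((if w + 1 = m then X.mulVec (f w) else f w) = (if w + 1 = m then X.mulVec (g w) else g w)) →
      f w = g w := by
    intro hU he
    by_cases h0 : w + 1 = m
    · rw [if_pos h0, if_pos h0] at he
      exact hinj hU _ _ he
    · rwa [if_neg h0, if_neg h0] at he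
  rcases k with i | i
  · simp only [SIdx.val] at hk hX
    simp only [act_pos_def] at h
    by_cases hi : i = 0
    · simp only [hi, if_true] at h
      exact e0 i (fun _ => hX (by simp [hi])) hi (h w hw)
    · simp only [hi, if_false] at h
      by_cases him : i = m
      · simp only [him, if_true] at h
        exact e1 (hX (by simp [him])) (h w hw)
      · simp only [him, if_false] at h
        have h1 := h (i-1) (by omega)
        rw [if_neg (by omega), if_pos (by omega), if_neg (by omega), if_pos (by omega)] at h1
        have h2 := h i (by omega)
        rw [if_pos rfl, if_pos rfl, h1] at h2
        have h2' := add_left_cancel h2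
        have h3 := h w hw
        by_cases a : w = i
        · rw [a, h1]
        · by_cases b : w + 1 = i
          · rw [show w = i - 1 by omega, h2']
          · rwa [if_neg a, if_neg b, if_neg a, if_neg b] at h3
  · simp only [SIdx.val] at hk hX
    simp only [act_neg_def] at h
    by_cases hi : i = 0
    · simp only [hi, if_true] at h
      exact e0 i (fun _ => hX (by simp [hi])) hi (h w hw)
    · simp only [hi, if_false] at h
      by_cases him : i = m
      · simp only [him, if_true] at h
        exact e1 (hX (by simp [him])) (h w hw)
      · simp only [him, if_false] at h
        have h2 := h i (by omega)
        rw [if_pos rfl, if_pos rfl] at h2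
        have h1 := h (i-1) (by omega)
        rw [if_neg (by omega), if_pos (by omega), if_neg (by omega), if_pos (by omega), h2] at h1
        have h1' := add_right_cancel h1
        have h3 := h w hw
        by_cases a : w = i
        · rw [a, h1']
        · by_cases b : w + 1 = i
          · rw [show w = i - 1 by omega, h2]
          · rwa [if_neg a, if_neg b, if_neg a, if_neg b] at h3

lemma elem_unit (hm : 2 ≤ m) (k : SIdx) (hk : k.val ≤ m) (X : Mt n)
    (hX : (k.val = 0 ∨ k.val = m) → IsUnit X) : IsUnit (elemMat m n k X) := by
  rw [← Matrix.mulVec_injective_iff_isUnit]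
  intro x y hxy
  apply W_ext
  apply act_inj hm k hk X hX
  intro w hw
  rw [← W_elem hm k hk X x w hw, ← W_elem hm k hk X y w hw]
  exact congrArg (fun v => W v w) hxy

lemma bigProd_unit (hm : 2 ≤ m) (z : List (SIdx × Mt n))
    (hz : ∀ a ∈ z, a.1.val ≤ m ∧ ((a.1.val = 0 ∨ a.1.val = m) → IsUnit a.2)) :
    IsUnit (bigProd m z) := by
  unfold bigProd
  induction z with
  | nil => simp
  | cons a z ih =>
    rw [List.map_cons, List.prod_cons]
    have h := hz a (by simp)
    exact (elem_unit hm a.1 h.1 a.2 h.2).mul (ih (fun b hb => hz b (by simp [hb])))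

lemma unit_mulVec_inj {N : Type*} [Fintype N] [DecidableEq N] {R : Matrix N N ℂ} (h : IsUnit R)
    {a b : N → ℂ} (hab : R.mulVec a = R.mulVec b) : a = b :=
  (Matrix.mulVec_injective_iff_isUnit.2 h) hab

/-- The three isomorphism clauses. -/
def IsoR {N : Type*} [Fintype N] (L : Matrix N N ℂ) (P : Mt n) (F : Matrix (Fin n) N ℂ) : Prop :=
  (∀ x, L.mulVec x = 0 → P.mulVec (F.mulVec x) = 0) ∧
  (∀ x y, L.mulVec x = 0 → L.mulVec y = 0 → F.mulVec x = F.mulVec y → x = y) ∧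
  (∀ z, P.mulVec z = 0 → ∃ x, L.mulVec x = 0 ∧ F.mulVec x = z)

lemma iso_main {sig tau sig2 tau2 : List SIdx} (H : RH m sig tau sig2 tau2) (A : ℕ → Mt n) (μ : ℂ)
    (hA0 : SIdx.neg 0 ∈ tau → IsUnit (A 0)) (hAm : SIdx.pos m ∈ sig → IsUnit (A m))
    (hdet : (Pol m A μ).det = 0) (z2 w2 : List (SIdx × Mt n))
    (hz : z2.map Prod.fst = sig2) (hw : w2.map Prod.fst = tau2)
    (uz : IsUnit (bigProd m z2)) (uw : IsUnit (bigProd m w2))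
    (G : Matrix (Fin m × Fin n) (Fin m × Fin n) ℂ) (hG : IsUnit G) :
    IsoR (G * Tm m A sig tau μ * (bigProd m z2 * bigProd m w2)) (Pol m A μ)
      (Fmat m n A sig tau sig2 tau2) := by
  obtain ⟨c, hc, hrec⟩ := recover (n := n) H A μ hA0 hAm hdet
  have hex : ∀ w, ∃ κ, w < m → HasKind sig tau w κ := by
    intro w
    by_cases h : w < m
    · obtain ⟨κ, hκ⟩ := exists_kind H w h
      exact ⟨κ, fun _ => hκ⟩
    · exact ⟨.k1, fun h' => absurd h' h⟩
  choose κ hκ using hex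
  have hker : ∀ x, (G * Tm m A sig tau μ * (bigProd m z2 * bigProd m w2)).mulVec x = 0 ↔
      (Tm m A sig tau μ).mulVec ((bigProd m z2).mulVec ((bigProd m w2).mulVec x)) = 0 := by
    intro x
    rw [← Matrix.mulVec_mulVec, ← Matrix.mulVec_mulVec, ← Matrix.mulVec_mulVec]
    constructor
    · intro h
      apply unit_mulVec_inj hG
      rw [h, Matrix.mulVec_zero]
    · intro h
      rw [h, Matrix.mulVec_zero]
  have hC : ∀ x, (G * Tm m A sig tau μ * (bigProd m z2 * bigProd m w2)).mulVec x = 0 →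
      ∃ u p q, Ctx m sig tau sig2 tau2 A μ κ u p q z2 w2 x := by
    intro x hx
    obtain ⟨u, p, q, h1, h2⟩ := ker_sol H A μ hA0 hAm κ hκ _ ((hker x).1 hx)
    exact ⟨u, p, q, H, hκ, h1, hz, hw, h2⟩
  refine ⟨?_, ?_, ?_⟩
  · intro x hx
    obtain ⟨u, p, q, C⟩ := hC x hx
    rw [hrec _ _ _ _ _ _ _ C, Matrix.mulVec_smul, C.hS.poly, smul_zero]
  · intro x y hx hy hxy
    have hd : (G * Tm m A sig tau μ * (bigProd m z2 * bigProd m w2)).mulVec (x - y) = 0 := by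
      rw [Matrix.mulVec_sub, hx, hy, sub_zero]
    obtain ⟨u, p, q, C⟩ := hC _ hd
    have h1 := hrec _ _ _ _ _ _ _ C
    rw [Matrix.mulVec_sub, hxy, sub_self] at h1
    have hu : u 0 = 0 := (smul_eq_zero.1 h1.symm).resolve_left hc
    have hz0 := C.hS.zero hu
    have hR : (bigProd m z2).mulVec ((bigProd m w2).mulVec (x - y)) = 0 := by
      apply W_ext
      intro w hw
      rw [C.hx w hw, W_zero]
      have a := hz0 w (by omega)
      have b := hz0 (w+1) (by omega)
      cases κ w <;> simp [Kd.sel, a, b]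
    have h3 : x - y = 0 := by
      apply unit_mulVec_inj uw
      apply unit_mulVec_inj uz
      rw [hR, Matrix.mulVec_zero, Matrix.mulVec_zero]
    exact sub_eq_zero.1 h3
  · intro z hzP
    obtain ⟨u, p, q, hS, hu⟩ := Sol.exists (m := m) A μ (fun i => (κ i).isS) (c⁻¹ • z)
      (by rw [Matrix.mulVec_smul, hzP, smul_zero])
    obtain ⟨y, hy⟩ := W_surj (m := m) (fun w => (κ w).sel u p q w)
    obtain ⟨y1, hy1⟩ := (Matrix.mulVec_surjective_iff_isUnit.2 uz) y
    obtain ⟨x, hx⟩ := (Matrix.mulVec_surjective_iff_isUnit.2 uw) y1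
    have hyx : (bigProd m z2).mulVec ((bigProd m w2).mulVec x) = y := by rw [hx, hy1]
    refine ⟨x, ?_, ?_⟩
    · rw [hker, hyx]
      exact sol_ker H A μ hA0 hAm κ hκ y u p q hS hy
    · have C : Ctx m sig tau sig2 tau2 A μ κ u p q z2 w2 x :=
        ⟨H, hκ, hS, hz, hw, by rw [hyx]; exact hy⟩
      rw [hrec _ _ _ _ _ _ _ C, hu, smul_smul, mul_inv_cancel₀ hc, one_smul]

lemma iso_basis {N : Type*} [Fintype N] {L : Matrix N N ℂ} {P : Mt n} {F : Matrix (Fin n) N ℂ}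
    (h : IsoR L P F) (k : ℕ) (Z : Matrix N (Fin k) ℂ) (hZ : ColsBasisKerRight L Z) :
    ColsBasisKerRight P (F * Z) := by
  obtain ⟨h1, h2, h3⟩ := h
  obtain ⟨z1, z2, z3⟩ := hZ
  have hcol : ∀ j, (fun i => (F * Z) i j) = F.mulVec (fun i => Z i j) := by
    intro j; funext i; rfl
  have hsp : ∀ x ∈ Submodule.span ℂ (Set.range fun j : Fin k => fun i => Z i j),
      L.mulVec x = 0 := by
    intro x hx
    have : Submodule.span ℂ (Set.range fun j : Fin k => fun i => Z i j) ≤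
        LinearMap.ker L.mulVecLin := by
      rw [Submodule.span_le]
      rintro _ ⟨j, rfl⟩
      simpa using z1 j
    simpa using this hx
  refine ⟨?_, ?_, ?_⟩
  · intro j
    rw [hcol]
    exact h1 _ (z1 j)
  · have := z2.map (f := F.mulVecLin) (by
      rw [Submodule.disjoint_def]
      intro x hx hx'
      have hx0 : F.mulVec x = 0 := by simpa using hx'
      exact h2 x 0 (hsp x hx) (Matrix.mulVec_zero _) (by rw [hx0, Matrix.mulVec_zero]))
    exact this
  · intro y hy
    obtain ⟨x, hx, rfl⟩ := h3 y hy
    have hxs := z3 x hx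
    have := Submodule.mem_map_of_mem (f := F.mulVecLin) hxs
    rw [Submodule.map_span, ← Set.range_comp] at this
    exact this

lemma elem_transpose (k : SIdx) (X : Mt n) : (elemMat m n k X)ᵀ = elemMat m n k Xᵀ := by
  ext ⟨a, i⟩ ⟨b, j⟩
  simp only [Matrix.transpose_apply, elemMat, Prod.mk.injEq]
  by_cases h0 : k.val = 0
  · simp only [h0, if_true]
    by_cases hab : a = b
    · subst hab; simp [eq_comm]
    · simp [hab, Ne.symm hab]
  · by_cases h1 : k.val = m
    · simp only [h0, h1, if_true, if_false]
      by_cases hab : a = b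
      · subst hab; simp [eq_comm]
      · simp [hab, Ne.symm hab]
    · simp only [h0, h1, if_false]
      exact if_congr and_comm rfl (if_congr (by rw [or_comm, and_comm, and_comm (a := (b : ℕ) = _)])
        (if_congr eq_comm rfl rfl) (if_congr and_comm rfl
          (if_congr (and_congr eq_comm eq_comm) rfl rfl)))

def tz (z : List (SIdx × Mt n)) : List (SIdx × Mt n) := (z.map fun a => (a.1, a.2ᵀ)).reverse

lemma tz_fst (z : List (SIdx × Mt n)) : (tz z).map Prod.fst = (z.map Prod.fst).reverse := by
  simp [tz, Function.comp_def]

lemma bigProd_transpose (z : List (SIdx × Mt n)) : (bigProd m z)ᵀ = bigProd m (tz z) := by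
  unfold bigProd tz
  rw [Matrix.transpose_list_prod, List.map_map, List.map_reverse, List.map_map]
  congr 2
  apply List.map_congr_left
  intro a _
  simp [elem_transpose]

lemma prodFiedler_transpose (A : ℕ → Mt n) (t : List SIdx) :
    (prodFiedler m n A t)ᵀ = prodFiedler m n (fun i => (A i)ᵀ) t.reverse := by
  unfold prodFiedler
  rw [Matrix.transpose_list_prod, List.map_map, List.map_reverse]
  congr 2
  apply List.map_congr_left
  intro a _
  simp only [Function.comp, elem_transpose]
  congr 1
  cases a <;> simp only [fiedlerX] <;> split_ifs <;> simp [Matrix.transpose_nonsing_inv]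

lemma Tm_transpose (A : ℕ → Mt n) (sig tau : List SIdx) (μ : ℂ) :
    (Tm m A sig tau μ)ᵀ = Tm m (fun i => (A i)ᵀ) sig.reverse tau.reverse μ := by
  simp only [Tm, Matrix.transpose_sub, Matrix.transpose_smul, prodFiedler_transpose]

lemma Pol_transpose (A : ℕ → Mt n) (μ : ℂ) :
    (Pol m A μ)ᵀ = Pol m (fun i => (A i)ᵀ) μ := by
  simp only [Pol, Matrix.transpose_sum, Matrix.transpose_smul]

lemma SIP.toL {α : List SIdx} (h : SIP α) : SIPL α := by
  rintro l1 a l2 l3 rfl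
  have := h ⟨l1.length, by simp⟩ ⟨l1.length + 1 + l2.length, by simp; omega⟩
    (by simp [Fin.lt_def]; omega) (by
      simp only [List.get_eq_getElem]
      rw [List.getElem_append_right (by simp), List.getElem_append_right (by omega)]
      simp only [Nat.sub_self, List.getElem_cons_zero]
      have e : l1.length + 1 + l2.length - l1.length = l2.length + 1 := by omega
      simp only [e, List.getElem_cons_succ]
      rw [List.getElem_append_right (by simp)]
      simp)
  obtain ⟨⟨c, hc⟩, h1, h2, h3⟩ := this
  simp only [Fin.lt_def] at h1 h2
  simp only [List.get_eq_getElem] at h3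
  rw [List.getElem_append_right (by omega)] at h3
  rw [List.getElem_append_right (by simp)] at h3
  obtain ⟨d, rfl⟩ : ∃ d, c = l1.length + (d + 1) := ⟨c - l1.length - 1, by omega⟩
  have e : l1.length + (d + 1) - l1.length = d + 1 := by omega
  simp only [e, Nat.sub_self, List.getElem_cons_zero, List.getElem_cons_succ] at h3
  rw [List.getElem_append_left (by omega)] at h3
  rw [← h3]
  exact List.getElem_mem _

lemma SIPL.reverse {α : List SIdx} (h : SIPL α) : SIPL α.reverse := by
  intro l1 a l2 l3 e
  have := h l3.reverse a l2.reverse l1.reverse (by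
    rw [← List.reverse_reverse α, e]; simp)
  simpa using this

lemma SIPL.leftPart {s l : List SIdx} (h : SIPL (s ++ l)) : SIPL s := by
  intro l1 b l2 l3 e
  exact h l1 b l2 (l3 ++ l) (by rw [e]; simp)

lemma RH.ofData (E : EGFPData m n) : RH m E.sig E.tau E.sig2 E.tau2 := by
  have hnd := E.hperm.nodup_iff.2 List.nodup_range
  rw [List.nodup_append] at hnd
  have hmem : ∀ i, i ∈ E.sig.map SIdx.val ++ E.tau.map SIdx.val ↔ i < m + 1 := by
    intro i; rw [E.hperm.mem_iff, List.mem_range]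
  have hp : ∀ k ∈ E.sig, k = .pos k.val := by
    intro k hk
    have := E.hsigpos k hk
    cases k
    · first | rfl | cases this
    · first | rfl | cases this
  have hn : ∀ k ∈ E.tau, k = .neg k.val := by
    intro k hk
    have := E.htauneg k hk
    cases k
    · first | rfl | cases this
    · first | rfl | cases this
  refine ⟨E.hm, ?_, ?_, ?_, ?_, hnd.1, hnd.2.1, E.hsig2, E.htau2, ?_, ?_⟩
  · intro k hk
    refine ⟨k.val, hp k hk, ?_⟩
    have := (hmem k.val).1 (List.mem_append_left _ (List.mem_map_of_mem hk))
    omega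
  · intro k hk
    refine ⟨k.val, hn k hk, ?_⟩
    have := (hmem k.val).1 (List.mem_append_right _ (List.mem_map_of_mem hk))
    omega
  · intro i hi
    have := (hmem i).2 (by omega)
    rcases List.mem_append.1 this with h | h
    · obtain ⟨k, hk, rfl⟩ := List.mem_map.1 h
      left; rw [← hp k hk]; exact hk
    · obtain ⟨k, hk, rfl⟩ := List.mem_map.1 h
      right; rw [← hn k hk]; exact hk
  · intro i hs ht
    exact hnd.2.2 i (List.mem_map.2 ⟨_, hs, rfl⟩) i (List.mem_map.2 ⟨_, ht, rfl⟩) rfl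
  · have := SIP.toL E.hSIPsig
    rw [List.append_assoc] at this
    exact this.suffix
  · have := SIP.toL E.hSIPtau
    rw [List.append_assoc] at this
    exact this.suffix

lemma RH.ofDataL (E : EGFPData m n) :
    RH m E.sig.reverse E.tau.reverse E.sig1.reverse E.tau1.reverse := by
  have H := RH.ofData E
  refine ⟨E.hm, ?_, ?_, ?_, ?_, ?_, ?_, ?_, ?_, ?_, ?_⟩
  · simpa using H.hpos
  · simpa using H.hneg
  · simpa using H.cover
  · simpa using H.disj
  · rw [List.map_reverse, List.nodup_reverse]; exact H.nds
  · rw [List.map_reverse, List.nodup_reverse]; exact H.ndt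
  · simpa using E.hsig1
  · simpa using E.htau1
  · rw [← List.reverse_append]; exact (SIP.toL E.hSIPsig).leftPart.reverse
  · rw [← List.reverse_append]; exact (SIP.toL E.hSIPtau).leftPart.reverse

lemma zip_fst (t : List SIdx) (Xs : List (Mt n)) (h : NonsingAssign m t Xs) :
    (t.zip Xs).map Prod.fst = t := List.map_fst_zip (le_of_eq h.1)

lemma zip_unit (hm : 2 ≤ m) (t : List SIdx) (Xs : List (Mt n)) (h : NonsingAssign m t Xs)
    (ht : ∀ k ∈ t, k.val ≤ m) : IsUnit (bigProd m (t.zip Xs)) := by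
  apply bigProd_unit hm
  intro a ha
  refine ⟨ht _ ?_, h.2 a ha⟩
  exact (List.of_mem_zip ha).1

lemma Lmu (E : EGFPData m n) (μ : ℂ) : μ • E.L1 - E.L0 =
    (bigProd m (E.tau1.zip E.Y1) * bigProd m (E.sig1.zip E.X1)) * Tm m E.A E.sig E.tau μ *
      (bigProd m (E.sig2.zip E.X2) * bigProd m (E.tau2.zip E.Y2)) := by
  simp only [EGFPData.L1, EGFPData.L0, Tm, Matrix.mul_sub, Matrix.sub_mul, Matrix.mul_smul,
    Matrix.smul_mul]
  rfl

end EG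
namespace EG

variable {m n : ℕ}

lemma isoRight (E : EGFPData m n) (μ : ℂ) (hμ : (Pol m E.A μ).det = 0) :
    IsoR (μ • E.L1 - E.L0) (Pol m E.A μ) (Fmat m n E.A E.sig E.tau E.sig2 E.tau2) := by
  have H := RH.ofData E
  have hs : ∀ k ∈ E.sig, k.val ≤ m := by
    intro k hk; obtain ⟨i, rfl, hi⟩ := H.hpos k hk; exact hi
  have ht : ∀ k ∈ E.tau, k.val ≤ m := by
    intro k hk; obtain ⟨i, rfl, hi⟩ := H.hneg k hk; exact hi
  rw [Lmu]
  exact iso_main H E.A μ E.hA0 E.hAmUnit hμ _ _ (zip_fst _ _ E.hX2) (zip_fst _ _ E.hY2)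
    (zip_unit E.hm _ _ E.hX2 fun k hk => hs k (E.hsig2 k hk).1)
    (zip_unit E.hm _ _ E.hY2 fun k hk => ht k (E.htau2 k hk).1) _
    ((zip_unit E.hm _ _ E.hY1 fun k hk => ht k (E.htau1 k hk).1).mul
      (zip_unit E.hm _ _ E.hX1 fun k hk => hs k (E.hsig1 k hk).1))

lemma isUnit_tr {N : Type*} [Fintype N] [DecidableEq N] {B : Matrix N N ℂ} (h : IsUnit B) :
    IsUnit Bᵀ := (Matrix.isUnit_transpose _).2 h

lemma isoLeft (E : EGFPData m n) (μ : ℂ) (hμ : (Pol m E.A μ).det = 0) :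
    IsoR (μ • E.L1 - E.L0)ᵀ (Pol m E.A μ)ᵀ (Fmat m n (fun i => (E.A i)ᵀ) E.sig.reverse
      E.tau.reverse E.sig1.reverse E.tau1.reverse) := by
  have H := RH.ofData E
  have hs : ∀ k ∈ E.sig, k.val ≤ m := by
    intro k hk; obtain ⟨i, rfl, hi⟩ := H.hpos k hk; exact hi
  have ht : ∀ k ∈ E.tau, k.val ≤ m := by
    intro k hk; obtain ⟨i, rfl, hi⟩ := H.hneg k hk; exact hi
  have hμ' : (Pol m (fun i => (E.A i)ᵀ) μ).det = 0 := by
    rw [← Pol_transpose, Matrix.det_transpose, hμ]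
  rw [Lmu, Matrix.transpose_mul, Matrix.transpose_mul (_ * _) (Tm _ _ _ _ _),
    Matrix.transpose_mul (bigProd m (E.tau1.zip _)) (bigProd m (E.sig1.zip _)),
    Tm_transpose, Pol_transpose, bigProd_transpose (E.tau1.zip _),
    bigProd_transpose (E.sig1.zip _), ← Matrix.mul_assoc]
  refine iso_main (RH.ofDataL E) (fun i => (E.A i)ᵀ) μ ?_ ?_ hμ' _ _ ?_ ?_ ?_ ?_ _ ?_
  · intro h; exact isUnit_tr (E.hA0 (by simpa using h))
  · intro h; exact isUnit_tr (E.hAmUnit (by simpa using h))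
  · rw [tz_fst, zip_fst _ _ E.hX1]
  · rw [tz_fst, zip_fst _ _ E.hY1]
  · rw [← bigProd_transpose]
    exact isUnit_tr (zip_unit E.hm _ _ E.hX1 fun k hk => hs k (E.hsig1 k hk).1)
  · rw [← bigProd_transpose]
    exact isUnit_tr (zip_unit E.hm _ _ E.hY1 fun k hk => ht k (E.htau1 k hk).1)
  · exact isUnit_tr ((zip_unit E.hm _ _ E.hX2 fun k hk => hs k (E.hsig2 k hk).1).mul
      (zip_unit E.hm _ _ E.hY2 fun k hk => ht k (E.htau2 k hk).1))

/-- the left recovery matrix, as in the statement -/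
noncomputable def Kmat (m n : ℕ) (A : ℕ → Matrix (Fin n) (Fin n) ℂ) (sig tau sig1 tau1 : List SIdx) :
    Matrix (Fin n) (Fin m × Fin n) ℂ :=
  let ω := tau.map SIdx.negate
  let c0 := consAt ω (.pos 0)
  if SIdx.pos 0 ∈ sig then
    (if invsAt sig (.pos 0) < (m : ℤ) then
      rowSel m n ((m : ℤ) - invsAt (sig1 ++ sig) (.pos 0))
    else ((A m)⁻¹)ᵀ * rowSel m n 1)
  else if SIdx.pos (c0.toNat + 1) ∈ sig then
    (if c0 + invsAt sig (.pos (c0.toNat + 1)) + 1 < (m : ℤ) then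
      rowSel m n ((m : ℤ) - (c0 + invsAt (sig1 ++ sig) (.pos (c0.toNat + 1)) + 1))
    else ((A m)⁻¹)ᵀ * rowSel m n (invsAt tau1 (.neg (m - 1)) + 2))
  else if c0 < (m : ℤ) then
    rowSel m n ((m : ℤ) - (c0 - invsAt tau1 (.neg c0.toNat) - 1))
  else ((A 0)⁻¹)ᵀ * rowSel m n (m : ℤ)

lemma Kmat_eq (A : ℕ → Mt n) (sig tau sig1 tau1 : List SIdx) :
    Fmat m n (fun i => (A i)ᵀ) sig.reverse tau.reverse sig1.reverse tau1.reverse =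
      Kmat m n A sig tau sig1 tau1 := by
  simp only [Fmat, Kmat, invsAt_eq, List.map_reverse, List.reverse_reverse, List.reverse_append,
    List.mem_reverse, Matrix.transpose_nonsing_inv]

end EG
/-- **eigenvector recovery at a finite eigenvalue.**  Let `P` be regular
with eigenvalue `μ`, and let `L(λ) = λ L₁ − L₀` be an EGFP of `P`.  With the recovery
matrices `F = F^EGFP(P)` and `K = K^EGFP(P)` defined by the six-fold case distinction of the
statement, `x ↦ F x` is a linear isomorphism `N_r(L(μ)) → N_r(P(μ))` and `y ↦ K y` is a
linear isomorphism `N_l(L(μ)) → N_l(P(μ))`; in particular bases of the null spaces of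
`L(μ)` are mapped to bases of the null spaces of `P(μ)`. -/
theorem egfp_eigenvector_recovery {m n : ℕ} (E : EGFPData m n)
    (hreg : (polyP m n E.A).det ≠ 0)
    (μ : ℂ)
    (hμ : (∑ i ∈ Finset.range (m + 1), μ ^ i • E.A i).det = 0) :
    let Pμ : Matrix (Fin n) (Fin n) ℂ := ∑ i ∈ Finset.range (m + 1), μ ^ i • E.A i
    let Lμ : Matrix (Fin m × Fin n) (Fin m × Fin n) ℂ := μ • E.L1 - E.L0
    let ω := E.tau.map SIdx.negate
    let i0 := invsAt ω (.pos 0)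
    let c0 := consAt ω (.pos 0)
    let F : Matrix (Fin n) (Fin m × Fin n) ℂ :=
      if SIdx.pos 0 ∈ E.sig then
        (if consAt E.sig (.pos 0) < (m : ℤ) then
          rowSel m n ((m : ℤ) - consAt (E.sig ++ E.sig2) (.pos 0))
        else (E.A m)⁻¹ * rowSel m n 1)
      else if SIdx.pos (i0.toNat + 1) ∈ E.sig then
        (if i0 + consAt E.sig (.pos (i0.toNat + 1)) + 1 < (m : ℤ) then
          rowSel m n ((m : ℤ) - (i0 + consAt (E.sig ++ E.sig2) (.pos (i0.toNat + 1)) + 1))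
        else (E.A m)⁻¹ * rowSel m n (consAt E.tau2 (.neg (m - 1)) + 2))
      else if i0 < (m : ℤ) then
        rowSel m n ((m : ℤ) - (i0 - consAt E.tau2 (.neg i0.toNat) - 1))
      else (E.A 0)⁻¹ * rowSel m n (m : ℤ)
    let K : Matrix (Fin n) (Fin m × Fin n) ℂ :=
      if SIdx.pos 0 ∈ E.sig then
        (if invsAt E.sig (.pos 0) < (m : ℤ) then
          rowSel m n ((m : ℤ) - invsAt (E.sig1 ++ E.sig) (.pos 0))
        else ((E.A m)⁻¹)ᵀ * rowSel m n 1)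
      else if SIdx.pos (c0.toNat + 1) ∈ E.sig then
        (if c0 + invsAt E.sig (.pos (c0.toNat + 1)) + 1 < (m : ℤ) then
          rowSel m n ((m : ℤ) - (c0 + invsAt (E.sig1 ++ E.sig) (.pos (c0.toNat + 1)) + 1))
        else ((E.A m)⁻¹)ᵀ * rowSel m n (invsAt E.tau1 (.neg (m - 1)) + 2))
      else if c0 < (m : ℤ) then
        rowSel m n ((m : ℤ) - (c0 - invsAt E.tau1 (.neg c0.toNat) - 1))
      else ((E.A 0)⁻¹)ᵀ * rowSel m n (m : ℤ)
    -- `x ↦ F x` is a linear isomorphism `N_r(L(μ)) → N_r(P(μ))`: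
    ((∀ x, Lμ.mulVec x = 0 → Pμ.mulVec (F.mulVec x) = 0) ∧
     (∀ x y, Lμ.mulVec x = 0 → Lμ.mulVec y = 0 → F.mulVec x = F.mulVec y → x = y) ∧
     (∀ z, Pμ.mulVec z = 0 → ∃ x, Lμ.mulVec x = 0 ∧ F.mulVec x = z)) ∧
    -- `y ↦ K y` is a linear isomorphism `N_l(L(μ)) → N_l(P(μ))`:
    ((∀ y, Matrix.vecMul y Lμ = 0 → Matrix.vecMul (K.mulVec y) Pμ = 0) ∧
     (∀ y y', Matrix.vecMul y Lμ = 0 → Matrix.vecMul y' Lμ = 0 →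
        K.mulVec y = K.mulVec y' → y = y') ∧
     (∀ w, Matrix.vecMul w Pμ = 0 → ∃ y, Matrix.vecMul y Lμ = 0 ∧ K.mulVec y = w)) ∧
    -- in particular, bases are mapped to bases:
    (∀ (p : ℕ) (Z : Matrix (Fin m × Fin n) (Fin p) ℂ),
      ColsBasisKerRight Lμ Z → ColsBasisKerRight Pμ (F * Z)) ∧
    (∀ (p : ℕ) (Z : Matrix (Fin m × Fin n) (Fin p) ℂ),
      ColsBasisKerLeft Lμ Z → ColsBasisKerLeft Pμ (K * Z)) := by
  intro Pμ Lμ ω i0 c0 F K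
  have hR : EG.IsoR Lμ Pμ F := EG.isoRight E μ hμ
  have hL : EG.IsoR Lμᵀ Pμᵀ K := by
    have h := EG.isoLeft E μ hμ
    rw [EG.Kmat_eq] at h
    exact h
  have hB : ∀ (p : ℕ) (Z : Matrix (Fin m × Fin n) (Fin p) ℂ),
      ColsBasisKerLeft Lμ Z → ColsBasisKerLeft Pμ (K * Z) := by
    intro p Z hZ
    have h := EG.iso_basis hL p Z (by
      simpa only [ColsBasisKerRight, ColsBasisKerLeft, Matrix.mulVec_transpose] using hZ)
    simpa only [ColsBasisKerRight, ColsBasisKerLeft, Matrix.mulVec_transpose] using h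
  refine ⟨hR, ?_, fun p Z hZ => EG.iso_basis hR p Z hZ, hB⟩
  simpa only [EG.IsoR, Matrix.mulVec_transpose] using hL
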